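/- arXiv:1910.03836 — 2 statements merged into one kernel-verified Lean document; each statement's English description precedes it below -/
import Mathlib

section
/- Let D, D₁, D₂ be topological discs in the Euclidean plane with D = D₁ ∪ D₂ and int D₁ ∩ int D₂ = ∅. Then the sets S₁ = D₁ ∩ ∂D, S₂ = D₂ ∩ ∂D, and S = ∂D₁ ∩ ∂D₂ are each simple continuous curves (homeomorphic images of a compact interval). -/
open Metric Set

noncomputable section

/-- A topological disc: a subset of the plane (identified with ℂ) homeomorphic to the
closed unit disc. -/
def IsTopologicalDisc (D : Set ℂ) : Prop :=
  Nonempty (D ≃ₜ (Metric.closedBall (0:ℂ) 1))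

/-- A (nondegenerate) simple continuous curve: the image of a continuous injective map
defined on a nondegenerate compact interval. -/
def IsSimpleCurve (S : Set ℂ) : Prop :=
  ∃ a b : ℝ, a < b ∧ ∃ c : ℝ → ℂ, ContinuousOn c (Set.Icc a b) ∧
    Set.InjOn c (Set.Icc a b) ∧ S = c '' Set.Icc a b

/-- Homotopy lifting for nonvanishing maps. -/
lemma exists_log_of_homotopy {A : Type} [TopologicalSpace A] (H : unitInterval × A → ℂ)
    (hH : Continuous H) (h0 : ∀ x, H x ≠ 0) (φ : A → ℂ) (hφ : Continuous φ)
    (h : ∀ a, H (0, a) = Complex.exp (φ a)) :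
    ∃ ψ : A → ℂ, Continuous ψ ∧ ∀ a, H (1, a) = Complex.exp (ψ a) := by
  let H' : C(unitInterval × A, {z : ℂ // z ≠ 0}) :=
    ⟨fun x => ⟨H x, h0 x⟩, hH.subtype_mk _⟩
  have key : ∀ a, H' (0, a) =
      (fun z : ℂ ↦ (⟨_, z.exp_ne_zero⟩ : {z : ℂ // z ≠ 0})) ((⟨φ, hφ⟩ : C(A, ℂ)) a) :=
    fun a => Subtype.ext (h a)
  let L := Complex.isCoveringMap_exp.liftHomotopy H' ⟨φ, hφ⟩ key
  refine ⟨fun a => L (1, a), L.continuous.comp (by fun_prop), fun a => ?_⟩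
  have := congrFun (Complex.isCoveringMap_exp.liftHomotopy_lifts H' ⟨φ, hφ⟩ key) (1, a)
  exact (congrArg Subtype.val this).symm

/-- Continuous logarithms exist on closed balls. -/
lemma exists_log_closedBall (f : ℂ → ℂ) (hf : ContinuousOn f (closedBall 0 1))
    (h0 : ∀ z ∈ closedBall (0:ℂ) 1, f z ≠ 0) :
    ∃ ψ : ℂ → ℂ, ContinuousOn ψ (closedBall 0 1) ∧
      ∀ z ∈ closedBall (0:ℂ) 1, f z = Complex.exp (ψ z) := by
  have hmem : ∀ x : unitInterval × closedBall (0:ℂ) 1,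
      ((x.1 : ℝ) : ℂ) * (x.2 : ℂ) ∈ closedBall (0:ℂ) 1 := by
    rintro ⟨t, z⟩
    have hz := z.2
    have ht := t.2
    rw [mem_closedBall_zero_iff] at *
    simp only [norm_mul, Complex.norm_real, Real.norm_eq_abs, abs_of_nonneg ht.1]
    exact mul_le_one₀ ht.2 (norm_nonneg _) hz
  obtain ⟨ψ, hψ, h⟩ := exists_log_of_homotopy (A := closedBall (0:ℂ) 1)
    (fun x => f (((x.1 : ℝ) : ℂ) * (x.2 : ℂ)))
    (hf.comp_continuous (by fun_prop) hmem) (fun x => h0 _ (hmem x))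
    (fun _ => Complex.log (f 0)) continuous_const (fun a => by
      simp [Complex.exp_log (h0 0 (by simp))])
  classical
  refine ⟨fun z => if hz : z ∈ closedBall (0:ℂ) 1 then ψ ⟨z, hz⟩ else 0, ?_, ?_⟩
  · rw [continuousOn_iff_continuous_domRestrict]
    have e : ((closedBall (0:ℂ) 1).domRestrict
        fun z => if hz : z ∈ closedBall (0:ℂ) 1 then ψ ⟨z, hz⟩ else 0) = ψ := by
      funext z
      exact dif_pos z.2
    rw [e]
    exact hψ
  · intro z hz
    have := h ⟨z, hz⟩
    simp only [Set.Icc.coe_one, Complex.ofReal_one, one_mul] at this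
    simp only [dif_pos hz, this]

/-- An odd nonvanishing map on the circle has no continuous logarithm. -/
lemma no_log_of_odd (g φ : sphere (0:ℂ) 1 → ℂ) (hφ : Continuous φ)
    (hodd : ∀ x, g (-x) = - g x) (h : ∀ x, g x = Complex.exp (φ x)) : False := by
  have hconn : IsPreconnected (univ : Set (sphere (0:ℂ) 1)) := by
    have := (isConnected_sphere (E := ℂ) (by simp) 0 (r := 1) zero_le_one).isPreconnected
    have := isPreconnected_iff_preconnectedSpace.mp this
    exact isPreconnected_univ
  have h1 : ∀ x, Complex.exp (φ (-x) - φ x) = -1 := by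
    intro x
    rw [Complex.exp_sub, ← h, ← h, hodd]
    have : g x ≠ 0 := by rw [h]; exact Complex.exp_ne_zero _
    field_simp
  have h2 : ∀ x, ∃ n : ℤ, φ (-x) - φ x = Real.pi * Complex.I + n * (2 * Real.pi * Complex.I) := by
    intro x
    rw [← Complex.exp_eq_exp_iff_exists_int, h1, Complex.exp_pi_mul_I]
  choose n hn using h2
  have hcont : Continuous (fun x => φ (-x) - φ x) := by fun_prop
  have hc : Continuous n := by
    have h3 : Continuous (fun x => ((n x : ℤ) : ℝ)) := by
      have h4 : (fun x => ((n x : ℤ) : ℝ)) = fun x => ((φ (-x) - φ x).im - Real.pi) / (2 * Real.pi) := by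
        ext x
        rw [hn x]
        have := Real.pi_ne_zero
        simp
      rw [h4]; fun_prop
    exact Int.isClosedEmbedding_coe_real.isInducing.continuous_iff.mpr h3
  let x0 : sphere (0:ℂ) 1 := ⟨1, by simp⟩
  have h5 : n x0 = n (-x0) := hconn.constant hc.continuousOn (mem_univ _) (mem_univ _)
  have h6 := hn x0
  have h7 := hn (-x0)
  rw [neg_neg, ← h5] at h7
  have h8 : (Real.pi : ℂ) * Complex.I + n x0 * (2 * Real.pi * Complex.I) = 0 := by
    linear_combination (-h6 - h7)/2
  have h9 : (1 + 2 * (n x0 : ℂ)) = 0 := by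
    have : (Real.pi : ℂ) * Complex.I ≠ 0 := by simp [Real.pi_ne_zero]
    apply mul_left_cancel₀ this
    linear_combination h8
  have : (1 + 2 * n x0 : ℤ) = 0 := by exact_mod_cast h9
  omega

/-- Local surjectivity of injective plane maps. -/
lemma ball_subset_image (f : ℂ → ℂ) (hf : ContinuousOn f (closedBall 0 1))
    (hi : InjOn f (closedBall 0 1)) : f 0 ∈ interior (f '' closedBall 0 1) := by
  have hsub : ∀ x : sphere (0:ℂ) 1, (x:ℂ) ∈ closedBall (0:ℂ) 1 := fun x =>
    sphere_subset_closedBall x.2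
  have hn : ∀ x : sphere (0:ℂ) 1, ‖(x:ℂ)‖ = 1 := fun x => by simp
  have hne : ∀ x : sphere (0:ℂ) 1, f x - f 0 ≠ 0 := by
    intro x hx
    have := hi (hsub x) (by simp) (sub_eq_zero.mp hx)
    have h1 := hn x
    rw [this] at h1
    simp at h1
  -- no log for f - f 0 on the circle
  have hnolog : ∀ φ : sphere (0:ℂ) 1 → ℂ, Continuous φ →
      (∀ x : sphere (0:ℂ) 1, f x - f 0 = Complex.exp (φ x)) → False := by
    intro φ hφ h
    have hm1 : ∀ x : unitInterval × sphere (0:ℂ) 1,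
        (x.2 : ℂ) * ((1 / (1 + (x.1:ℝ)) : ℝ) : ℂ) ∈ closedBall (0:ℂ) 1 := by
      rintro ⟨t, x⟩
      have h0 := t.2.1
      rw [mem_closedBall_zero_iff, norm_mul, hn, Complex.norm_real, Real.norm_eq_abs,
        abs_of_nonneg (by positivity), one_mul, div_le_one (by positivity)]
      linarith
    have hm2 : ∀ x : unitInterval × sphere (0:ℂ) 1,
        (x.2 : ℂ) * ((- ((x.1:ℝ) / (1 + (x.1:ℝ))) : ℝ) : ℂ) ∈ closedBall (0:ℂ) 1 := by
      rintro ⟨t, x⟩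
      have h0 := t.2.1
      rw [mem_closedBall_zero_iff, norm_mul, hn, Complex.norm_real, Real.norm_eq_abs,
        abs_neg, abs_of_nonneg (by positivity), one_mul, div_le_one (by positivity)]
      linarith
    have hpos : ∀ x : unitInterval × sphere (0:ℂ) 1, 1 + (x.1:ℝ) ≠ 0 := fun x => by
      have := x.1.2.1; positivity
    have hc1 : Continuous fun x : unitInterval × sphere (0:ℂ) 1 => 
        (x.2 : ℂ) * ((1 / (1 + (x.1:ℝ)) : ℝ) : ℂ) := by
      have : Continuous fun x : unitInterval × sphere (0:ℂ) 1 => (1 / (1 + (x.1:ℝ)) : ℝ) :=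
        Continuous.div (by fun_prop) (by fun_prop) hpos
      fun_prop
    have hc2 : Continuous fun x : unitInterval × sphere (0:ℂ) 1 => 
        (x.2 : ℂ) * ((- ((x.1:ℝ) / (1 + (x.1:ℝ))) : ℝ) : ℂ) := by
      have : Continuous fun x : unitInterval × sphere (0:ℂ) 1 => ((x.1:ℝ) / (1 + (x.1:ℝ)) : ℝ) :=
        Continuous.div (by fun_prop) (by fun_prop) hpos
      fun_prop
    obtain ⟨ψ, hψ, hh⟩ := exists_log_of_homotopy
      (fun x : unitInterval × sphere (0:ℂ) 1 => f ((x.2 : ℂ) * ((1 / (1 + (x.1:ℝ)) : ℝ) : ℂ)) -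
        f ((x.2 : ℂ) * ((- ((x.1:ℝ) / (1 + (x.1:ℝ))) : ℝ) : ℂ)))
      ((hf.comp_continuous hc1 hm1).sub (hf.comp_continuous hc2 hm2))
      (by
        intro x hx
        have h1 := hi (hm1 x) (hm2 x) (sub_eq_zero.mp hx)
        have hx0 : (x.2 : ℂ) ≠ 0 := by
          intro h0
          have := hn x.2
          rw [h0] at this; simp at this
        have h2 := mul_left_cancel₀ hx0 h1
        have h3 : (1 / (1 + (x.1:ℝ)) : ℝ) = - ((x.1:ℝ) / (1 + (x.1:ℝ))) := by exact_mod_cast h2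
        have h4 := hpos x
        field_simp at h3
        have := x.1.2.1
        linarith)
      φ hφ (by intro a; simpa using h a)
    refine no_log_of_odd _ ψ hψ ?_ hh
    intro x
    have e : (1 / (1 + ((1 : unitInterval) : ℝ)) : ℝ) = 
        ((1 : unitInterval) : ℝ) / (1 + ((1 : unitInterval) : ℝ)) := by simp
    simp only [e]
    rw [neg_sub]
    congr 2 <;> · push_cast; simp
  -- lower bound
  obtain ⟨δ, hδ, hb⟩ : ∃ δ > 0, ∀ x : sphere (0:ℂ) 1, δ ≤ ‖f x - f 0‖ := by
    have hcs : IsCompact (univ : Set (sphere (0:ℂ) 1)) := isCompact_univ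
    have hcc : Continuous fun x : sphere (0:ℂ) 1 => ‖f x - f 0‖ :=
      ((hf.comp_continuous continuous_subtype_val hsub).sub continuous_const).norm
    obtain ⟨x0, -, hx0⟩ := hcs.exists_isMinOn ⟨⟨1, by simp⟩, mem_univ _⟩ hcc.continuousOn
    exact ⟨_, norm_pos_iff.mpr (hne x0), fun x => hx0 (mem_univ x)⟩
  rw [mem_interior_iff_mem_nhds]
  refine Filter.mem_of_superset (ball_mem_nhds _ hδ) ?_
  intro y hy
  by_contra hny
  obtain ⟨ψ, hψ, h⟩ := exists_log_closedBall (fun z => f z - y) (hf.sub continuousOn_const)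
    (fun z hz h0 => hny ⟨z, hz, sub_eq_zero.mp h0⟩)
  rw [mem_ball_iff_norm] at hy
  obtain ⟨χ, hχ, h'⟩ := exists_log_of_homotopy
    (fun x : unitInterval × sphere (0:ℂ) 1 =>
      f x.2 - f 0 - (1 - ((x.1 : ℝ) : ℂ)) * (y - f 0))
    (by
      have : Continuous fun x : unitInterval × sphere (0:ℂ) 1 => f x.2 :=
        hf.comp_continuous (by fun_prop) (fun x => hsub x.2)
      exact (this.sub continuous_const).sub (by fun_prop))
    (by
      intro x hx
      have h1 := hb x.2
      rw [sub_eq_zero.mp hx, norm_mul] at h1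
      have h2 : ‖(1 - ((x.1 : ℝ) : ℂ))‖ ≤ 1 := by
        rw [← Complex.ofReal_one, ← Complex.ofReal_sub, Complex.norm_real, Real.norm_eq_abs,
          abs_le]
        have := x.1.2.1
        have := x.1.2.2
        constructor <;> linarith
      nlinarith [norm_nonneg (y - f 0)])
    (fun x => ψ x) (hψ.comp_continuous continuous_subtype_val hsub)
    (fun a => by rw [← h a (hsub a)]; simp)
  exact hnolog χ hχ (fun x => by rw [← h' x]; simp)

/-- Injective continuous maps on compact sets have continuous inverses. -/
lemma exists_cont_inverse {X Y : Type} [TopologicalSpace X] [Nonempty X] [TopologicalSpace Y]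
    [T2Space Y] (F : X → Y) (K : Set X) (hK : IsCompact K)
    (hc : ContinuousOn F K) (hi : InjOn F K) :
    ∃ G : Y → X, ContinuousOn G (F '' K) ∧ ∀ x ∈ K, G (F x) = x := by
  have hG : ∀ x ∈ K, Function.invFunOn F K (F x) = x := fun x hx =>
    hi.leftInvOn_invFunOn hx
  refine ⟨Function.invFunOn F K, ?_, hG⟩
  rw [continuousOn_iff_isClosed]
  intro t ht
  refine ⟨F '' (K ∩ t), ((hK.inter_right ht).image_of_continuousOn
    (hc.mono inter_subset_left)).isClosed, ?_⟩
  ext y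
  constructor
  · rintro ⟨hy, x, hx, rfl⟩
    rw [mem_preimage, hG x hx] at hy
    exact ⟨⟨x, ⟨hx, hy⟩, rfl⟩, ⟨x, hx, rfl⟩⟩
  · rintro ⟨⟨x, ⟨hx, hxt⟩, rfl⟩, h⟩
    refine ⟨?_, h⟩
    rw [mem_preimage, hG x hx]
    exact hxt

/-- Invariance of domain in the plane. -/
lemma isOpen_image_plane (f : ℂ → ℂ) (U : Set ℂ) (hU : IsOpen U) (hf : ContinuousOn f U)
    (hi : InjOn f U) : IsOpen (f '' U) := by
  rw [isOpen_iff_mem_nhds]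
  rintro _ ⟨x, hx, rfl⟩
  obtain ⟨r, hr, hrU⟩ := Metric.nhds_basis_closedBall.mem_iff.mp (hU.mem_nhds hx)
  have hmaps : MapsTo (fun z : ℂ => x + r * z) (closedBall 0 1) U := by
    intro z hz
    apply hrU
    rw [mem_closedBall_zero_iff] at hz
    rw [mem_closedBall_iff_norm, add_sub_cancel_left, norm_mul, Complex.norm_real,
      Real.norm_eq_abs, abs_of_pos hr]
    exact mul_le_of_le_one_right hr.le hz
  have h := ball_subset_image (fun z => f (x + r * z)) (hf.comp (by fun_prop) hmaps) (by
    intro a ha b hb hab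
    have := hi (hmaps ha) (hmaps hb) hab
    have hr' : (r : ℂ) ≠ 0 := by exact_mod_cast hr.ne'
    exact mul_left_cancel₀ hr' (add_left_cancel this))
  rw [mem_interior_iff_mem_nhds] at h
  simp only [mul_zero, add_zero] at h
  refine Filter.mem_of_superset h ?_
  rintro _ ⟨z, hz, rfl⟩
  exact ⟨_, hmaps hz, rfl⟩

/-- `F` parametrizes the disc `D`. -/
structure DiscMap (F : ℂ → ℂ) (D : Set ℂ) : Prop where
  cont : ContinuousOn F (closedBall 0 1)
  inj : InjOn F (closedBall 0 1)
  img : F '' closedBall 0 1 = D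

lemma IsTopologicalDisc.exists_map {D : Set ℂ} (h : IsTopologicalDisc D) : ∃ F, DiscMap F D := by
  obtain ⟨h⟩ := h
  classical
  have e : ∀ z : closedBall (0:ℂ) 1, (fun z : ℂ => if hz : z ∈ closedBall (0:ℂ) 1 then
      (h.symm ⟨z, hz⟩ : ℂ) else 0) z = h.symm z := fun z => dif_pos z.2
  refine ⟨fun z => if hz : z ∈ closedBall (0:ℂ) 1 then (h.symm ⟨z, hz⟩ : ℂ) else 0, ?_, ?_, ?_⟩
  · rw [continuousOn_iff_continuous_domRestrict]
    have : ((closedBall (0:ℂ) 1).domRestrict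
        fun z => if hz : z ∈ closedBall (0:ℂ) 1 then (h.symm ⟨z, hz⟩ : ℂ) else 0) =
        fun z => (h.symm z : ℂ) := by
      funext z
      exact e z
    rw [this]
    fun_prop
  · intro a ha b hb hab
    have h1 := (e ⟨a, ha⟩).symm.trans (hab.trans (e ⟨b, hb⟩))
    have h2 := h.symm.injective (Subtype.ext h1)
    exact congrArg Subtype.val h2
  · ext y
    constructor
    · rintro ⟨z, hz, rfl⟩
      have := e ⟨z, hz⟩
      dsimp only at this ⊢
      rw [this]
      exact Subtype.coe_prop _
    · intro hy
      refine ⟨h ⟨y, hy⟩, Subtype.coe_prop _, ?_⟩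
      rw [e]
      simp

namespace DiscMap
variable {F : ℂ → ℂ} {D : Set ℂ}

lemma isCompact (h : DiscMap F D) : IsCompact D := by
  rw [← h.img]; exact (isCompact_closedBall 0 1).image_of_continuousOn h.cont

lemma isClosed (h : DiscMap F D) : IsClosed D := h.isCompact.isClosed

lemma preconn (h : DiscMap F D) : IsPreconnected D := by
  rw [← h.img]; exact isPreconnected_closedBall.image _ h.cont

lemma interior_eq (h : DiscMap F D) : interior D = F '' ball 0 1 := by
  apply Subset.antisymm
  · intro y hy
    obtain ⟨x, hx, rfl⟩ : y ∈ F '' closedBall 0 1 := by rw [h.img]; exact interior_subset hy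
    obtain ⟨G, hG, hGF⟩ := exists_cont_inverse F _ (isCompact_closedBall 0 1) h.cont h.inj
    rw [h.img] at hG
    have ho := isOpen_image_plane G (interior D) isOpen_interior (hG.mono interior_subset) (by
      intro a ha b hb hab
      obtain ⟨a, ha', rfl⟩ : a ∈ F '' closedBall 0 1 := by rw [h.img]; exact interior_subset ha
      obtain ⟨b, hb', rfl⟩ : b ∈ F '' closedBall 0 1 := by rw [h.img]; exact interior_subset hb
      rw [hGF a ha', hGF b hb'] at hab
      rw [hab])
    have hsub : G '' interior D ⊆ closedBall 0 1 := by
      rintro _ ⟨a, ha, rfl⟩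
      obtain ⟨a, ha', rfl⟩ : a ∈ F '' closedBall 0 1 := by rw [h.img]; exact interior_subset ha
      rw [hGF a ha']; exact ha'
    have h2 := interior_maximal hsub ho
    rw [interior_closedBall _ one_ne_zero] at h2
    refine ⟨x, h2 ⟨F x, hy, hGF x hx⟩, rfl⟩
  · apply interior_maximal
    · rw [← h.img]; exact image_mono ball_subset_closedBall
    · exact isOpen_image_plane F _ isOpen_ball (h.cont.mono ball_subset_closedBall)
        (h.inj.mono ball_subset_closedBall)

lemma frontier_eq (h : DiscMap F D) : frontier D = F '' sphere 0 1 := by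
  rw [h.isClosed.frontier_eq, h.interior_eq, ← h.img, ← h.inj.image_sdiff_subset
    ball_subset_closedBall, closedBall_sdiff_ball]

lemma interior_nonempty (h : DiscMap F D) : (interior D).Nonempty := by
  rw [h.interior_eq]; exact ⟨F 0, 0, by simp, rfl⟩

lemma interior_preconn (h : DiscMap F D) : IsPreconnected (interior D) := by
  rw [h.interior_eq]
  exact isPreconnected_ball.image _ (h.cont.mono ball_subset_closedBall)

lemma subset_closure (h : DiscMap F D) : D ⊆ closure (interior D) := by
  rw [h.interior_eq, ← h.img]
  have := h.cont
  rw [← closure_ball (0:ℂ) one_ne_zero] at this ⊢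
  exact this.image_closure

lemma diff_preconn (h : DiscMap F D) (p : ℂ) : IsPreconnected (D \ {p}) := by
  by_cases hp : p ∈ D
  swap
  · rw [sdiff_singleton_eq_self hp]; exact h.preconn
  rw [← h.img] at hp
  obtain ⟨x, hx, rfl⟩ := hp
  have e : D \ {F x} = F '' (closedBall 0 1 \ {x}) := by
    rw [h.inj.image_sdiff_subset (by simpa using hx), h.img, image_singleton]
  rw [e]
  refine IsPreconnected.image ?_ _ (h.cont.mono sdiff_subset)
  by_cases hx1 : x ∈ ball (0:ℂ) 1
  · have hc : Continuous fun z : ℂ => ((1 / max 1 ‖z‖ : ℝ) : ℂ) * z := by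
      have : Continuous fun z : ℂ => (1 / max 1 ‖z‖ : ℝ) :=
        Continuous.div (by fun_prop) (by fun_prop) (fun z => by positivity)
      fun_prop
    have hpc := (isConnected_compl_singleton_of_one_lt_rank (E := ℂ) (by simp) x).isPreconnected
    have := hpc.image _ hc.continuousOn
    convert this using 1
    rw [mem_ball_zero_iff] at hx1
    ext z
    constructor
    · rintro ⟨hz, hzx⟩
      rw [mem_closedBall_zero_iff] at hz
      exact ⟨z, hzx, by simp [max_eq_left hz]⟩
    · rintro ⟨w, hw, rfl⟩
      have hm : (0:ℝ) < max 1 ‖w‖ := by positivity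
      have hnorm : ‖((1 / max 1 ‖w‖ : ℝ) : ℂ) * w‖ = ‖w‖ / max 1 ‖w‖ := by
        rw [norm_mul, Complex.norm_real, Real.norm_eq_abs, abs_of_pos (by positivity)]
        field_simp
      constructor
      · rw [mem_closedBall_zero_iff]
        dsimp only
        rw [hnorm, div_le_one hm]
        exact le_max_right _ _
      · intro hwx
        rw [mem_singleton_iff] at hwx
        dsimp only at hwx
        rw [hwx] at hnorm
        rcases le_total ‖w‖ 1 with hle | hle
        · apply hw
          rw [mem_singleton_iff, ← hwx]
          simp [max_eq_left hle]
        · rw [max_eq_right hle, div_self (by linarith)] at hnorm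
          linarith
  · refine (isPreconnected_ball (x := (0:ℂ)) (r := 1)).subset_closure ?_ ?_
    · intro z hz
      refine ⟨ball_subset_closedBall hz, ?_⟩
      rintro rfl
      exact hx1 hz
    · rw [closure_ball _ one_ne_zero]; exact sdiff_subset

end DiscMap

/-- A continuous map on a preconnected set with trivial exponential is constant. -/
lemma eq_of_exp_eq_one (s : Set ℂ) (hs : IsPreconnected s) (h : ℂ → ℂ) (hc : ContinuousOn h s)
    (he : ∀ x ∈ s, Complex.exp (h x) = 1) {a b : ℂ} (ha : a ∈ s) (hb : b ∈ s) : h a = h b := by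
  have h2 : ∀ x : s, ∃ n : ℤ, h x = n * (2 * Real.pi * Complex.I) := by
    intro x
    exact Complex.exp_eq_one_iff.mp (he x x.2)
  choose n hn using h2
  have hcn : Continuous n := by
    have h3 : Continuous (fun x => ((n x : ℤ) : ℝ)) := by
      have h4 : (fun x => ((n x : ℤ) : ℝ)) = fun x : s => (h x).im / (2 * Real.pi) := by
        ext x
        rw [hn x]
        have := Real.pi_ne_zero
        simp
      rw [h4]
      have := hc.domRestrict
      exact (Complex.continuous_im.comp this).div_const _
    exact Int.isClosedEmbedding_coe_real.isInducing.continuous_iff.mpr h3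
  have := isPreconnected_iff_preconnectedSpace.mp hs
  have h5 : n ⟨a, ha⟩ = n ⟨b, hb⟩ := isPreconnected_univ.constant hcn.continuousOn
    (mem_univ _) (mem_univ _)
  have h6 := hn ⟨a, ha⟩
  have h7 := hn ⟨b, hb⟩
  rw [h5] at h6
  exact h6.trans h7.symm

/-- Unicoherence of the disc. -/
lemma DiscMap.unicoherent {F : ℂ → ℂ} {D : Set ℂ} (h : DiscMap F D) {D1 D2 : Set ℂ}
    (hu : D = D1 ∪ D2) (c1 : IsClosed D1) (c2 : IsClosed D2)
    (p1 : IsPreconnected D1) (p2 : IsPreconnected D2) : IsPreconnected (D1 ∩ D2) := by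
  rw [isPreconnected_closed_iff]
  intro t t' ht ht' hcov ⟨a, haS, hat⟩ ⟨b, hbS, hbt⟩
  by_contra hne
  rw [not_nonempty_iff_eq_empty] at hne
  have hdisj : Disjoint (D1 ∩ D2 ∩ t) (D1 ∩ D2 ∩ t') := by
    rw [Set.disjoint_left]
    rintro x ⟨hx, hxt⟩ ⟨-, hxt'⟩
    have : x ∈ D1 ∩ D2 ∩ (t ∩ t') := ⟨hx, hxt, hxt'⟩
    rw [hne] at this
    exact this
  obtain ⟨u, hu0, hu1, -⟩ := exists_continuous_zero_one_of_isClosed ((c1.inter c2).inter ht)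
    ((c1.inter c2).inter ht') hdisj
  classical
  let f : ℂ → ℂ := fun x => if x ∈ D1 then Complex.exp (Real.pi * Complex.I * u x)
    else Complex.exp (-(Real.pi * Complex.I * u x))
  have f1 : ∀ x ∈ D1, f x = Complex.exp (Real.pi * Complex.I * u x) := fun x hx => if_pos hx
  have f2 : ∀ x ∈ D2, f x = Complex.exp (-(Real.pi * Complex.I * u x)) := by
    intro x hx
    by_cases hx1 : x ∈ D1
    · rw [f1 x hx1]
      rcases hcov ⟨hx1, hx⟩ with hxt | hxt
      · have : u x = 0 := hu0 ⟨⟨hx1, hx⟩, hxt⟩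
        simp [this]
      · have : u x = 1 := hu1 ⟨⟨hx1, hx⟩, hxt⟩
        simp [this, Complex.exp_neg, Complex.exp_pi_mul_I]
    · exact if_neg hx1
  have uc : Continuous fun x => (u x : ℂ) := Complex.continuous_ofReal.comp u.continuous
  have fc : ContinuousOn f D := by
    rw [hu]
    refine ContinuousOn.union_of_isClosed ?_ ?_ c1 c2
    · exact ContinuousOn.congr (by fun_prop) f1
    · exact ContinuousOn.congr (by fun_prop) f2
  have fne : ∀ x, f x ≠ 0 := by
    intro x
    by_cases hx1 : x ∈ D1
    · rw [f1 x hx1]; exact Complex.exp_ne_zero _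
    · have : f x = _ := if_neg hx1
      rw [this]; exact Complex.exp_ne_zero _
  have hFm : MapsTo F (closedBall 0 1) D := by rw [← h.img]; exact mapsTo_image _ _
  obtain ⟨ψ, hψ, hψe⟩ := exists_log_closedBall (fun z => f (F z)) (fc.comp h.cont hFm)
    (fun z _ => fne _)
  obtain ⟨G, hG, hGF⟩ := exists_cont_inverse F _ (isCompact_closedBall 0 1) h.cont h.inj
  rw [h.img] at hG
  have hGm : MapsTo G D (closedBall 0 1) := by
    intro x hx
    rw [← h.img] at hx
    obtain ⟨z, hz, rfl⟩ := hx
    rw [hGF z hz]; exact hz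
  have hφc : ContinuousOn (fun x => ψ (G x)) D := hψ.comp hG hGm
  have hφ : ∀ x ∈ D, f x = Complex.exp (ψ (G x)) := by
    intro x hx
    rw [← h.img] at hx
    obtain ⟨z, hz, rfl⟩ := hx
    rw [hGF z hz, ← hψe z hz]
  have s1 : D1 ⊆ D := by rw [hu]; exact subset_union_left
  have s2 : D2 ⊆ D := by rw [hu]; exact subset_union_right
  have e1 := eq_of_exp_eq_one D1 p1 (fun x => ψ (G x) - Real.pi * Complex.I * u x)
    ((hφc.mono s1).sub (by fun_prop)) (fun x hx => by
      rw [Complex.exp_sub, ← hφ x (s1 hx), f1 x hx, div_self (Complex.exp_ne_zero _)])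
    haS.1 hbS.1
  have e2 := eq_of_exp_eq_one D2 p2 (fun x => ψ (G x) - -(Real.pi * Complex.I * u x))
    ((hφc.mono s2).sub (by fun_prop)) (fun x hx => by
      rw [Complex.exp_sub, ← hφ x (s2 hx), f2 x hx, div_self (Complex.exp_ne_zero _)])
    haS.2 hbS.2
  have ua : u a = 0 := hu0 ⟨haS, hat⟩
  have ub : u b = 1 := hu1 ⟨hbS, hbt⟩
  simp only [ua, ub, Complex.ofReal_zero, Complex.ofReal_one, mul_zero, mul_one] at e1 e2
  have : (Real.pi : ℂ) * Complex.I = 0 := by linear_combination (e1 - e2)/2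
  simp [Real.pi_ne_zero] at this

/-- `S` is an arc with endpoints `p` and `q`. -/
def IsArcFT (S : Set ℂ) (p q : ℂ) : Prop :=
  ∃ a b : ℝ, a < b ∧ ∃ c : ℝ → ℂ, ContinuousOn c (Set.Icc a b) ∧
    Set.InjOn c (Set.Icc a b) ∧ S = c '' Set.Icc a b ∧ c a = p ∧ c b = q

lemma IsArcFT.simple {S : Set ℂ} {p q : ℂ} (h : IsArcFT S p q) : IsSimpleCurve S := by
  obtain ⟨a, b, hab, c, h1, h2, h3, -⟩ := h
  exact ⟨a, b, hab, c, h1, h2, h3⟩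

lemma IsArcFT.preconn {S : Set ℂ} {p q : ℂ} (h : IsArcFT S p q) : IsPreconnected S := by
  obtain ⟨a, b, hab, c, h1, h2, rfl, -⟩ := h
  exact isPreconnected_Icc.image _ h1

lemma IsArcFT.subset_closure {S : Set ℂ} {p q : ℂ} (h : IsArcFT S p q) :
    S ⊆ closure (S \ {p, q}) := by
  obtain ⟨a, b, hab, c, h1, h2, rfl, rfl, rfl⟩ := h
  have hs : c '' Ioo a b ⊆ c '' Icc a b \ {c a, c b} := by
    rintro _ ⟨t, ht, rfl⟩
    have ht' := Ioo_subset_Icc_self ht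
    refine ⟨⟨t, ht', rfl⟩, ?_⟩
    rintro (h | h)
    · exact ht.1.ne' (h2 ht' (left_mem_Icc.mpr hab.le) h)
    · exact ht.2.ne (h2 ht' (right_mem_Icc.mpr hab.le) h)
  refine Subset.trans ?_ (closure_mono hs)
  rw [← closure_Ioo hab.ne] at h1 ⊢
  exact h1.image_closure

lemma IsArcFT.endpoint_iff {S : Set ℂ} {p q : ℂ} (h : IsArcFT S p q) {x : ℂ} (hx : x ∈ S) :
    IsPreconnected (S \ {x}) ↔ x ∈ ({p, q} : Set ℂ) := by
  obtain ⟨a, b, hab, c, h1, h2, rfl, rfl, rfl⟩ := h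
  obtain ⟨t, ht, rfl⟩ := hx
  have e : c '' Icc a b \ {c t} = c '' (Icc a b \ {t}) := by
    rw [h2.image_sdiff_subset (by simpa using ht), image_singleton]
  rw [e]
  constructor
  · intro hp
    obtain ⟨G, hG, hGc⟩ := exists_cont_inverse c _ isCompact_Icc h1 h2
    have h3 := hp.image G (hG.mono (image_mono sdiff_subset))
    have e2 : G '' (c '' (Icc a b \ {t})) = Icc a b \ {t} := by
      rw [image_image]
      ext s
      constructor
      · rintro ⟨r, hr, rfl⟩
        dsimp only
        rw [hGc r hr.1]; exact hr
      · intro hs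
        exact ⟨s, hs, hGc s hs.1⟩
    rw [e2] at h3
    by_contra hne
    simp only [mem_insert_iff, mem_singleton_iff, not_or] at hne
    have hta : t ≠ a := fun h => hne.1 (h ▸ rfl)
    have htb : t ≠ b := fun h => hne.2 (h ▸ rfl)
    have := h3.Icc_subset (a := a) (b := b) ⟨left_mem_Icc.mpr hab.le, fun h => hta h.symm⟩
      ⟨right_mem_Icc.mpr hab.le, fun h => htb h.symm⟩ ht
    exact this.2 rfl
  · intro h
    refine IsPreconnected.image ?_ _ (h1.mono sdiff_subset)
    rcases h with h | h
    · have := h2 ht (left_mem_Icc.mpr hab.le) h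
      subst this
      rw [Icc_sdiff_left]
      exact isPreconnected_Ioc
    · have := h2 ht (right_mem_Icc.mpr hab.le) h
      subst this
      rw [Icc_sdiff_right]
      exact isPreconnected_Ico

lemma IsArcFT.left_mem {S : Set ℂ} {p q : ℂ} (h : IsArcFT S p q) : p ∈ S := by
  obtain ⟨a, b, hab, c, h1, h2, rfl, rfl, rfl⟩ := h
  exact ⟨a, left_mem_Icc.mpr hab.le, rfl⟩

lemma IsArcFT.right_mem {S : Set ℂ} {p q : ℂ} (h : IsArcFT S p q) : q ∈ S := by
  obtain ⟨a, b, hab, c, h1, h2, rfl, rfl, rfl⟩ := h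
  exact ⟨b, right_mem_Icc.mpr hab.le, rfl⟩

lemma IsArcFT.endpoints_eq {S : Set ℂ} {p q p' q' : ℂ} (h : IsArcFT S p q)
    (h' : IsArcFT S p' q') : ({p, q} : Set ℂ) = {p', q'} := by
  have s : ({p, q} : Set ℂ) ⊆ S := by
    rintro x (rfl | rfl)
    exacts [h.left_mem, h.right_mem]
  have s' : ({p', q'} : Set ℂ) ⊆ S := by
    rintro x (rfl | rfl)
    exacts [h'.left_mem, h'.right_mem]
  ext x
  constructor
  · intro hx
    exact (h'.endpoint_iff (s hx)).mp ((h.endpoint_iff (s hx)).mpr hx)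
  · intro hx
    exact (h.endpoint_iff (s' hx)).mp ((h'.endpoint_iff (s' hx)).mpr hx)

/-- Angular coordinate on the circle minus a point. -/
lemma circle_coord {p : ℂ} (hp : ‖p‖ = 1) :
    ContinuousOn (fun z => Complex.arg (-z / p)) (sphere (0:ℂ) 1 \ {p}) ∧
    ∀ z ∈ sphere (0:ℂ) 1 \ {p}, z = -p * Complex.exp (Complex.arg (-z / p) * Complex.I) ∧
      Complex.arg (-z / p) < Real.pi := by
  have hp0 : p ≠ 0 := by rintro rfl; simp at hp
  have hn : ∀ z ∈ sphere (0:ℂ) 1 \ {p}, ‖-z / p‖ = 1 := by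
    rintro z ⟨hz, -⟩
    rw [mem_sphere_zero_iff_norm] at hz
    rw [norm_div, norm_neg, hz, hp, div_one]
  have hz : ∀ z ∈ sphere (0:ℂ) 1 \ {p}, z = -p * Complex.exp (Complex.arg (-z / p) * Complex.I) := by
    intro z hz
    have h1 := Complex.norm_mul_exp_arg_mul_I (-z / p)
    rw [hn z hz, Complex.ofReal_one, one_mul] at h1
    rw [h1]; field_simp
  have hs : ∀ z ∈ sphere (0:ℂ) 1 \ {p}, -z / p ∈ Complex.slitPlane := by
    intro z hzm
    rw [Complex.mem_slitPlane_iff_arg]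
    constructor
    · intro h
      have h1 := hz z hzm
      rw [h, Complex.exp_pi_mul_I] at h1
      apply hzm.2
      rw [mem_singleton_iff, h1]; ring
    · intro h
      have := hn z hzm
      rw [h] at this; simp at this
  refine ⟨?_, fun z hzm => ⟨hz z hzm, ?_⟩⟩
  · intro z hzm
    have h1 := Complex.continuousAt_arg (hs z hzm)
    exact (ContinuousAt.comp (f := fun z => -z / p) h1 (by fun_prop)).continuousWithinAt
  · exact lt_of_le_of_ne (Complex.arg_le_pi _) (Complex.mem_slitPlane_iff_arg.mp (hs z hzm)).1

/-- A circle cannot be properly contained in a circle. -/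
lemma theta {F : ℂ → ℂ} (hc : ContinuousOn F (sphere 0 1)) (hi : InjOn F (sphere 0 1))
    {A B : Set ℂ} {p q : ℂ} (hA : IsPreconnected A) (hB : IsPreconnected B) (hpq : p ≠ q)
    (hpA : p ∈ A) (hqA : q ∈ A) (hpB : p ∈ B) (hqB : q ∈ B) (hAB : A ∩ B ⊆ {p, q})
    (hsub : A ∪ B ⊆ F '' sphere 0 1) : A ∪ B = F '' sphere 0 1 := by
  refine Subset.antisymm hsub ?_
  rintro _ ⟨y, hy, rfl⟩
  by_contra hny
  obtain ⟨G, hG, hGF⟩ := exists_cont_inverse F _ (isCompact_sphere 0 1) hc hi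
  obtain ⟨k1, k2⟩ := circle_coord (p := y) (by simpa using hy)
  have hm : MapsTo G (A ∪ B) (sphere (0:ℂ) 1 \ {y}) := by
    intro x hx
    obtain ⟨z, hz, rfl⟩ := hsub hx
    rw [hGF z hz]
    refine ⟨hz, ?_⟩
    rintro rfl
    exact hny hx
  have hgc : ContinuousOn (fun x => Complex.arg (-(G x) / y)) (A ∪ B) :=
    k1.comp (hG.mono hsub) hm
  have hgi : InjOn (fun x => Complex.arg (-(G x) / y)) (A ∪ B) := by
    intro a ha b hb hab
    have h1 := (k2 _ (hm ha)).1
    have h2 := (k2 _ (hm hb)).1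
    dsimp only at hab
    rw [hab, ← h2] at h1
    obtain ⟨z, hz, rfl⟩ := hsub ha
    obtain ⟨w, hw, rfl⟩ := hsub hb
    rw [hGF z hz, hGF w hw] at h1
    rw [h1]
  generalize (fun x => Complex.arg (-(G x) / y)) = g at hgc hgi
  have key : ∀ p q, p ∈ A → q ∈ A → p ∈ B → q ∈ B → A ∩ B ⊆ {p, q} → g p < g q → False := by
    intro p q hpA hqA hpB hqB hAB hlt
    obtain ⟨m, hm1, hm2⟩ := exists_between hlt
    obtain ⟨x, hx, hxm⟩ := hA.intermediate_value hpA hqA (hgc.mono subset_union_left)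
      ⟨hm1.le, hm2.le⟩
    obtain ⟨x', hx', hxm'⟩ := hB.intermediate_value hpB hqB (hgc.mono subset_union_right)
      ⟨hm1.le, hm2.le⟩
    have := hgi (Or.inl hx) (Or.inr hx') (hxm.trans hxm'.symm)
    subst this
    rcases hAB ⟨hx, hx'⟩ with h | h
    · rw [h] at hxm; exact hm1.ne hxm
    · rw [h] at hxm; exact hm2.ne hxm.symm
  have hne : g p ≠ g q := fun h => hpq (hgi (Or.inl hpA) (Or.inl hqA) h)
  rcases lt_or_gt_of_ne hne with h | h
  · exact key p q hpA hqA hpB hqB hAB h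
  · exact key q p hqA hpA hqB hpB (by rwa [pair_comm]) h

/-- Two arcs of a circle determined by two angles. -/
lemma circle_arcs {F : ℂ → ℂ} (hc : ContinuousOn F (sphere 0 1)) (hi : InjOn F (sphere 0 1))
    {a b : ℝ} (hab : a < b) (hba : b < a + 2 * Real.pi) :
    ∃ p q A, p ≠ q ∧ IsArcFT ((fun t : ℝ => F (Complex.exp (t * Complex.I))) '' Icc a b) p q ∧
      IsArcFT A q p ∧
      A ∪ ((fun t : ℝ => F (Complex.exp (t * Complex.I))) '' Icc a b) = F '' sphere 0 1 ∧
      A ∩ ((fun t : ℝ => F (Complex.exp (t * Complex.I))) '' Icc a b) = {p, q} := by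
  have hE : ∀ t : ℝ, Complex.exp (t * Complex.I) ∈ sphere (0:ℂ) 1 := by
    intro t; rw [mem_sphere_zero_iff_norm, Complex.norm_exp_ofReal_mul_I]
  set c : ℝ → ℂ := fun t : ℝ => F (Complex.exp (t * Complex.I)) with hcdef
  have cc : Continuous c := hc.comp_continuous (by fun_prop) hE
  have hper : Function.Periodic c (2 * Real.pi) := by
    intro t
    simp only [hcdef]
    congr 1
    push_cast
    rw [add_mul, Complex.exp_add, Complex.exp_two_pi_mul_I, mul_one]
  have ceq : ∀ s t : ℝ, c s = c t → ∃ n : ℤ, s = t + n * (2 * Real.pi) := by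
    intro s t h
    have h1 := hi (hE s) (hE t) h
    obtain ⟨n, hn⟩ := Complex.exp_eq_exp_iff_exists_int.mp h1
    refine ⟨n, ?_⟩
    have h2 := congrArg Complex.im hn
    simpa using h2
  have hπ := Real.pi_pos
  have cinj : ∀ u v : ℝ, v < u + 2 * Real.pi → InjOn c (Icc u v) := by
    intro u v huv s hs t ht hst
    obtain ⟨n, hn⟩ := ceq s t hst
    have h1 : (n : ℝ) < 1 := by
      by_contra hcon
      push Not at hcon
      nlinarith [hs.1, hs.2, ht.1, ht.2]
    have h2 : (-1 : ℝ) < n := by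
      by_contra hcon
      push Not at hcon
      nlinarith [hs.1, hs.2, ht.1, ht.2]
    have h3 : n < 1 := by exact_mod_cast h1
    have h4 : -1 < n := by exact_mod_cast h2
    have : n = 0 := by omega
    rw [this] at hn
    simpa using hn
  refine ⟨c a, c b, c '' Icc b (a + 2 * Real.pi), ?_, ⟨a, b, hab, c, cc.continuousOn, cinj _ _ hba,
    rfl, rfl, rfl⟩, ⟨b, a + 2 * Real.pi, hba, c, cc.continuousOn, cinj _ _ (by linarith), rfl, rfl,
    hper a⟩, ?_, ?_⟩
  · intro h
    exact hab.ne (cinj a b hba (left_mem_Icc.mpr hab.le) (right_mem_Icc.mpr hab.le) h)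
  · apply Subset.antisymm
    · rintro x (⟨t, -, rfl⟩ | ⟨t, -, rfl⟩)
      · exact ⟨_, hE t, rfl⟩
      · exact ⟨_, hE t, rfl⟩
    · rintro _ ⟨z, hz, rfl⟩
      have hz' : F z = c (Complex.arg z) := by
        rw [mem_sphere_zero_iff_norm] at hz
        have := Complex.norm_mul_exp_arg_mul_I z
        rw [hz, Complex.ofReal_one, one_mul] at this
        simp only [hcdef, this]
      obtain ⟨s, hs, hs'⟩ := hper.exists_mem_Ico (by positivity) (Complex.arg z) a
      rw [hz', hs']
      rcases le_total s b with h | h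
      · exact Or.inr ⟨s, ⟨hs.1, h⟩, rfl⟩
      · exact Or.inl ⟨s, ⟨h, hs.2.le⟩, rfl⟩
  · apply Subset.antisymm
    · rintro _ ⟨⟨s, hs, rfl⟩, ⟨t, ht, hst⟩⟩
      obtain ⟨n, hn⟩ := ceq _ _ hst
      have h1 : (n : ℝ) < 1 := by
        by_contra hcon
        push Not at hcon
        nlinarith [hs.1, hs.2, ht.1, ht.2]
      have h2 : (-2 : ℝ) < n := by
        by_contra hcon
        push Not at hcon
        nlinarith [hs.1, hs.2, ht.1, ht.2]
      have h3 : n < 1 := by exact_mod_cast h1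
      have h4 : -2 < n := by exact_mod_cast h2
      have : n = 0 ∨ n = -1 := by omega
      rcases this with rfl | rfl
      · right
        have : s = b := by
          simp at hn
          linarith [hs.1, ht.2]
        rw [this]; rfl
      · left
        have : t = a := by
          push_cast at hn
          linarith [hs.2, ht.1]
        rw [← hst, this]
    · rintro x (rfl | rfl)
      · exact ⟨⟨a + 2 * Real.pi, ⟨hba.le, le_rfl⟩, hper a⟩, ⟨a, left_mem_Icc.mpr hab.le, rfl⟩⟩
      · exact ⟨⟨b, left_mem_Icc.mpr hba.le, rfl⟩, ⟨b, right_mem_Icc.mpr hab.le, rfl⟩⟩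

lemma loop_subset_loop {F G : ℂ → ℂ} (hc : ContinuousOn F (sphere 0 1))
    (hi : InjOn F (sphere 0 1)) (hc' : ContinuousOn G (sphere 0 1)) (hi' : InjOn G (sphere 0 1))
    (h : F '' sphere 0 1 ⊆ G '' sphere 0 1) : F '' sphere 0 1 = G '' sphere 0 1 := by
  have hπ := Real.pi_pos
  obtain ⟨p, q, A, hpq, h1, h2, h3, h4⟩ := circle_arcs hc hi (a := 0) (b := Real.pi) hπ
    (by linarith)
  rw [← h3] at h ⊢
  exact theta hc' hi' h2.preconn h1.preconn hpq h2.right_mem h2.left_mem h1.left_mem h1.right_mem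
    h4.subset h

lemma loop_split {F : ℂ → ℂ} (hc : ContinuousOn F (sphere 0 1)) (hi : InjOn F (sphere 0 1))
    {S : Set ℂ} (hS : IsCompact S) (hsub : S ⊆ F '' sphere 0 1) (hne : S ≠ F '' sphere 0 1)
    (hp : IsPreconnected S) (hnt : S.Nontrivial) :
    ∃ p q A, p ≠ q ∧ IsArcFT S p q ∧ IsArcFT A q p ∧ A ∪ S = F '' sphere 0 1 ∧
      A ∩ S = {p, q} := by
  obtain ⟨y, hy, hyS⟩ : ∃ y ∈ sphere (0:ℂ) 1, F y ∉ S := by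
    by_contra hcon
    push Not at hcon
    apply hne
    refine Subset.antisymm hsub ?_
    rintro _ ⟨z, hz, rfl⟩
    exact hcon z hz
  obtain ⟨G, hG, hGF⟩ := exists_cont_inverse F _ (isCompact_sphere 0 1) hc hi
  have hy1 : ‖y‖ = 1 := by simpa using hy
  obtain ⟨k1, k2⟩ := circle_coord hy1
  have hm : MapsTo G S (sphere (0:ℂ) 1 \ {y}) := by
    intro x hx
    obtain ⟨z, hz, rfl⟩ := hsub hx
    rw [hGF z hz]
    refine ⟨hz, ?_⟩
    rintro rfl
    exact hyS hx
  have hgc : ContinuousOn (fun x => Complex.arg (-(G x) / y)) S :=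
    k1.comp (hG.mono hsub) hm
  have hα : -y = Complex.exp (Complex.arg (-y) * Complex.I) := by
    have := Complex.norm_mul_exp_arg_mul_I (-y)
    rw [norm_neg, hy1, Complex.ofReal_one, one_mul] at this
    exact this.symm
  set α := Complex.arg (-y) with hαd
  let g : ℂ → ℝ := fun x => α + Complex.arg (-(G x) / y)
  have gc : ContinuousOn g S := continuousOn_const.add hgc
  have hFg : ∀ x ∈ S, F (Complex.exp (g x * Complex.I)) = x := by
    intro x hx
    have h1 := (k2 _ (hm hx)).1
    have h2 : Complex.exp (g x * Complex.I) = G x := by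
      rw [h1, hα]
      simp only [g]
      push_cast
      rw [add_mul, Complex.exp_add, ← hα, ← h1]
    rw [h2]
    obtain ⟨z, hz, rfl⟩ := hsub hx
    rw [hGF z hz]
  have hcomp : IsCompact (g '' S) := hS.image_of_continuousOn gc
  have hconn : IsConnected (g '' S) := ⟨hnt.nonempty.image g, hp.image g gc⟩
  have hIcc := eq_Icc_of_connected_compact hconn hcomp
  set a := sInf (g '' S)
  set b := sSup (g '' S)
  have hrange : ∀ t ∈ g '' S, α - Real.pi < t ∧ t < α + Real.pi := by
    rintro _ ⟨x, hx, rfl⟩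
    have h1 := (k2 _ (hm hx)).2
    have h2 := Complex.neg_pi_lt_arg (-(G x) / y)
    simp only [g]
    constructor <;> linarith
  have hSe : S = (fun t : ℝ => F (Complex.exp (t * Complex.I))) '' Icc a b := by
    rw [← hIcc]
    ext x
    constructor
    · intro hx
      exact ⟨g x, ⟨x, hx, rfl⟩, hFg x hx⟩
    · rintro ⟨_, ⟨w, hw, rfl⟩, rfl⟩
      dsimp only
      rw [hFg w hw]; exact hw
  have hab : a < b := by
    obtain ⟨x, hx, x', hx', hxx⟩ := hnt
    have h1 : g x ∈ Icc a b := by rw [← hIcc]; exact ⟨x, hx, rfl⟩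
    have h2 : g x' ∈ Icc a b := by rw [← hIcc]; exact ⟨x', hx', rfl⟩
    by_contra hcon
    push Not at hcon
    apply hxx
    rw [← hFg x hx, ← hFg x' hx']
    have : g x = g x' := by linarith [h1.1, h1.2, h2.1, h2.2]
    rw [this]
  have ha := hrange a (by rw [hIcc]; exact left_mem_Icc.mpr hab.le)
  have hb := hrange b (by rw [hIcc]; exact right_mem_Icc.mpr hab.le)
  have := circle_arcs hc hi hab (by linarith)
  rwa [← hSe] at this

namespace DiscMap

lemma sphere_cont {F : ℂ → ℂ} {D : Set ℂ} (h : DiscMap F D) : ContinuousOn F (sphere 0 1) :=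
  h.cont.mono sphere_subset_closedBall

lemma sphere_inj {F : ℂ → ℂ} {D : Set ℂ} (h : DiscMap F D) : InjOn F (sphere 0 1) :=
  h.inj.mono sphere_subset_closedBall

variable {F F1 F2 : ℂ → ℂ} {D D1 D2 : Set ℂ}

lemma interior_disj (h2 : DiscMap F2 D2)
    (hint : interior D1 ∩ interior D2 = ∅) : interior D1 ∩ D2 = ∅ := by
  rw [eq_empty_iff_forall_notMem]
  rintro x ⟨hx1, hx2⟩
  obtain ⟨y, hy1, hy2⟩ := mem_closure_iff.mp (h2.subset_closure hx2) _ isOpen_interior hx1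
  have : y ∈ interior D1 ∩ interior D2 := ⟨hy1, hy2⟩
  rw [hint] at this
  exact this

lemma inter_eq (h1 : DiscMap F1 D1) (h2 : DiscMap F2 D2)
    (hint : interior D1 ∩ interior D2 = ∅) : D1 ∩ D2 = frontier D1 ∩ frontier D2 := by
  have e1 := h2.interior_disj hint
  have e2 := h1.interior_disj (D1 := D2) (by rwa [inter_comm] at hint)
  rw [h1.isClosed.frontier_eq, h2.isClosed.frontier_eq]
  ext x
  constructor
  · rintro ⟨hx1, hx2⟩
    refine ⟨⟨hx1, fun h => ?_⟩, ⟨hx2, fun h => ?_⟩⟩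
    · exact (e1.subset ⟨h, hx2⟩ : x ∈ (∅ : Set ℂ))
    · exact (e2.subset ⟨h, hx1⟩ : x ∈ (∅ : Set ℂ))
  · rintro ⟨hx1, hx2⟩
    exact ⟨hx1.1, hx2.1⟩

lemma frontier_diff (h : DiscMap F D) (h1 : DiscMap F1 D1) (h2 : DiscMap F2 D2)
    (hu : D = D1 ∪ D2) {x : ℂ} (hx2 : x ∉ D2) (hx1 : x ∈ frontier D1) : x ∈ frontier D := by
  rw [h.isClosed.frontier_eq]
  rw [h1.isClosed.frontier_eq] at hx1
  refine ⟨by rw [hu]; exact Or.inl hx1.1, fun hx => hx1.2 ?_⟩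
  refine mem_interior.mpr ⟨interior D \ D2, ?_, isOpen_interior.sdiff h2.isClosed, hx, hx2⟩
  rintro y ⟨hy, hy2⟩
  have := interior_subset hy
  rw [hu] at this
  exact this.resolve_right hy2

lemma frontier_sub (h : DiscMap F D) (h1 : DiscMap F1 D1) (h2 : DiscMap F2 D2)
    (hu : D = D1 ∪ D2) : frontier D ⊆ frontier D1 ∪ frontier D2 := by
  rw [hu]
  refine (frontier_union_subset D1 D2).trans ?_
  exact union_subset_union inter_subset_left inter_subset_right

lemma inter_ne (h : DiscMap F D) (h1 : DiscMap F1 D1) (h2 : DiscMap F2 D2)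
    (hu : D = D1 ∪ D2) (hint : interior D1 ∩ interior D2 = ∅) : D1 ∩ D2 ≠ frontier D1 := by
  intro hS
  have hS' := h1.inter_eq h2 hint
  have e1 : frontier D1 = frontier D2 := by
    have : frontier D1 ⊆ frontier D2 := by rw [← hS, hS']; exact inter_subset_right
    rw [h1.frontier_eq, h2.frontier_eq] at *
    exact loop_subset_loop h1.sphere_cont h1.sphere_inj h2.sphere_cont h2.sphere_inj this
  have e2 : frontier D = frontier D1 := by
    have := h.frontier_sub h1 h2 hu
    rw [← e1, union_self] at this
    rw [h1.frontier_eq, h.frontier_eq] at *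
    exact loop_subset_loop h.sphere_cont h.sphere_inj h1.sphere_cont h1.sphere_inj this
  have hsub : interior D ⊆ interior D1 ∪ interior D2 := by
    intro x hx
    have hxD := interior_subset hx
    have hxf : x ∉ frontier D := by
      rw [h.isClosed.frontier_eq]; exact fun h => h.2 hx
    rw [hu] at hxD
    rcases hxD with hxD | hxD
    · left
      by_contra hn
      apply hxf
      rw [e2, h1.isClosed.frontier_eq]
      exact ⟨hxD, hn⟩
    · right
      by_contra hn
      apply hxf
      rw [e2, e1, h2.isClosed.frontier_eq]
      exact ⟨hxD, hn⟩
  have i1 : interior D1 ⊆ interior D := interior_mono (by rw [hu]; exact subset_union_left)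
  have i2 : interior D2 ⊆ interior D := interior_mono (by rw [hu]; exact subset_union_right)
  obtain ⟨x, hx⟩ := h1.interior_nonempty
  obtain ⟨y, hy⟩ := h2.interior_nonempty
  rcases IsPreconnected.subset_or_subset isOpen_interior isOpen_interior
    (disjoint_iff_inter_eq_empty.mpr hint) hsub h.interior_preconn with hs | hs
  · exact (hint.subset ⟨hs (i2 hy), hy⟩ : y ∈ (∅ : Set ℂ))
  · exact (hint.subset ⟨hx, hs (i1 hx)⟩ : x ∈ (∅ : Set ℂ))

lemma exists_ne (h : DiscMap F D) (p : ℂ) : ∃ x ∈ D, x ≠ p := by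
  have hm : ∀ z ∈ closedBall (0:ℂ) 1, F z ∈ D := fun z hz => by
    rw [← h.img]; exact ⟨z, hz, rfl⟩
  by_cases h0 : F 0 = p
  · refine ⟨F 1, hm 1 (by simp), fun h1 => ?_⟩
    have := h.inj (by simp) (by simp) (h0.trans h1.symm)
    simp at this
  · exact ⟨F 0, hm 0 (by simp), h0⟩

lemma inter_nontrivial (h : DiscMap F D) (h1 : DiscMap F1 D1) (h2 : DiscMap F2 D2)
    (hu : D = D1 ∪ D2) : (D1 ∩ D2).Nontrivial := by
  have key : ∀ p, ¬ (D1 ∩ D2 ⊆ {p}) := by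
    intro p hp
    have hc := isPreconnected_closed_iff.mp (h.diff_preconn p) D1 D2 h1.isClosed h2.isClosed
      (by rw [← hu]; exact sdiff_subset)
    obtain ⟨x, hx, hxp⟩ := h1.exists_ne p
    obtain ⟨y, hy, hyp⟩ := h2.exists_ne p
    obtain ⟨z, hz, hz'⟩ := hc ⟨x, ⟨by rw [hu]; exact Or.inl hx, hxp⟩, hx⟩
      ⟨y, ⟨by rw [hu]; exact Or.inr hy, hyp⟩, hy⟩
    exact hz.2 (hp hz')
  rw [← not_subsingleton_iff]
  intro hs
  rcases hs.eq_empty_or_singleton with he | ⟨p, he⟩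
  · exact key 0 (by rw [he]; exact empty_subset _)
  · exact key p he.subset

end DiscMap

/-- If a topological disc `D` is the union of two topological discs
`D₁, D₂` with disjoint interiors, then `D₁ ∩ ∂D`, `D₂ ∩ ∂D` and `∂D₁ ∩ ∂D₂` are simple
continuous curves. -/
theorem dissection_of_disc_into_two_boundary_curves
    (D D1 D2 : Set ℂ)
    (hD : IsTopologicalDisc D) (h1 : IsTopologicalDisc D1) (h2 : IsTopologicalDisc D2)
    (hunion : D = D1 ∪ D2)
    (hint : interior D1 ∩ interior D2 = ∅) :
    IsSimpleCurve (D1 ∩ frontier D) ∧ IsSimpleCurve (D2 ∩ frontier D) ∧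
      IsSimpleCurve (frontier D1 ∩ frontier D2) := by
  obtain ⟨F, h⟩ := hD.exists_map
  obtain ⟨F1, h1⟩ := h1.exists_map
  obtain ⟨F2, h2⟩ := h2.exists_map
  have hint' : interior D2 ∩ interior D1 = ∅ := by rwa [inter_comm] at hint
  have hunion' : D = D2 ∪ D1 := by rwa [union_comm] at hunion
  have hSe := h1.inter_eq h2 hint
  have hSp : IsPreconnected (D1 ∩ D2) := h.unicoherent hunion h1.isClosed h2.isClosed h1.preconn
    h2.preconn
  have hSc : IsCompact (D1 ∩ D2) := h1.isCompact.inter_right h2.isClosed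
  have hSn := h.inter_nontrivial h1 h2 hunion
  have n1 := h.inter_ne h1 h2 hunion hint
  have n2 := h.inter_ne h2 h1 hunion' hint'
  rw [inter_comm] at n2
  have s1 : D1 ∩ D2 ⊆ frontier D1 := by rw [hSe]; exact inter_subset_left
  have s2 : D1 ∩ D2 ⊆ frontier D2 := by rw [hSe]; exact inter_subset_right
  rw [← hSe]
  have t1 := h1.frontier_eq
  have t2 := h2.frontier_eq
  have t := h.frontier_eq
  obtain ⟨p, q, A, hpq, hS, hA, hAu, hAi⟩ := loop_split h1.sphere_cont h1.sphere_inj hSc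
    (t1 ▸ s1) (t1 ▸ n1) hSp hSn
  obtain ⟨p', q', B, hpq', hS', hB, hBu, hBi⟩ := loop_split h2.sphere_cont h2.sphere_inj hSc
    (t2 ▸ s2) (t2 ▸ n2) hSp hSn
  have hends := hS.endpoints_eq hS'
  rw [← t1] at hAu
  rw [← t2] at hBu
  have A1 : A ⊆ frontier D1 := by rw [← hAu]; exact subset_union_left
  have B2 : B ⊆ frontier D2 := by rw [← hBu]; exact subset_union_left
  have f1 : frontier D1 ⊆ D1 := h1.isClosed.frontier_subset
  have f2 : frontier D2 ⊆ D2 := h2.isClosed.frontier_subset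
  have AD : A ⊆ frontier D := by
    refine hA.subset_closure.trans (closure_minimal ?_ isClosed_frontier)
    rintro x ⟨hx, hxn⟩
    refine h.frontier_diff h1 h2 hunion (fun hx2 => hxn ?_) (A1 hx)
    rw [pair_comm, ← hAi]
    exact ⟨hx, f1 (A1 hx), hx2⟩
  have BD : B ⊆ frontier D := by
    refine hB.subset_closure.trans (closure_minimal ?_ isClosed_frontier)
    rintro x ⟨hx, hxn⟩
    refine h.frontier_diff h2 h1 hunion' (fun hx1 => hxn ?_) (B2 hx)
    rw [pair_comm, ← hBi]
    exact ⟨hx, hx1, f2 (B2 hx)⟩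
  have pqB : ({p, q} : Set ℂ) ⊆ B := by rw [hends, ← hBi]; exact inter_subset_left
  have pqA : ({p, q} : Set ℂ) ⊆ A := by rw [← hAi]; exact inter_subset_left
  have hAB : A ∪ B = frontier D := by
    rw [t]
    refine theta h.sphere_cont h.sphere_inj hA.preconn hB.preconn hpq hA.right_mem hA.left_mem
      (pqB (Or.inl rfl)) (pqB (Or.inr rfl)) ?_ (t ▸ union_subset AD BD)
    rintro x ⟨hxA, hxB⟩
    rw [← hAi]
    exact ⟨hxA, f1 (A1 hxA), f2 (B2 hxB)⟩
  have r1 : D1 ∩ frontier D = A := by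
    apply Subset.antisymm
    · rintro x ⟨hx, hxf⟩
      rw [← hAB] at hxf
      rcases hxf with hxf | hxf
      · exact hxf
      · apply pqA
        rw [hends, ← hBi]
        exact ⟨hxf, hx, f2 (B2 hxf)⟩
    · exact fun x hx => ⟨f1 (A1 hx), AD hx⟩
  have r2 : D2 ∩ frontier D = B := by
    apply Subset.antisymm
    · rintro x ⟨hx, hxf⟩
      rw [← hAB] at hxf
      rcases hxf with hxf | hxf
      · apply pqB
        rw [← hAi]
        exact ⟨hxf, f1 (A1 hxf), hx⟩
      · exact hxf
    · exact fun x hx => ⟨f2 (B2 hx), BD hx⟩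
  rw [r1, r2]
  exact ⟨hA.simple, hB.simple, hS.simple⟩
end
end

section
/- Let F and G be equidecomposable multicurves in the Euclidean plane, and let F′ ⊆ F and G′ ⊆ G be subfamilies that are themselves equidecomposable multicurves. Then the multicurves F \ F′ and G \ G′ are equidecomposable. -/
open Metric Set

noncomputable section

/-- A parameterized continuous simple curve in the plane (identified with ℂ):
a continuous injective map on a nondegenerate compact interval. -/
structure SimpleCurve where
  a : ℝ
  b : ℝ
  hab : a < b
  f : ℝ → ℂ
  cont : ContinuousOn f (Set.Icc a b)
  inj : Set.InjOn f (Set.Icc a b)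

/-- The point set of a simple curve. -/
def SimpleCurve.carrier (c : SimpleCurve) : Set ℂ := c.f '' Set.Icc c.a c.b

/-- The endpoints of a simple curve. -/
def SimpleCurve.endpoints (c : SimpleCurve) : Set ℂ := {c.f c.a, c.f c.b}

/-- Two simple curves are congruent if an isometry of the plane maps one onto the
other. -/
def SimpleCurve.Congr (c d : SimpleCurve) : Prop :=
  ∃ g : ℂ ≃ᵢ ℂ, g '' c.carrier = d.carrier

/-- The underlying point set of a family of simple curves. -/
def MCUnion (F : Set SimpleCurve) : Set ℂ := ⋃ c ∈ F, c.carrier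

/-- A multicurve: a finite family of continuous simple curves such that every point of
the plane belongs to at most one member, or is an endpoint of exactly two members. -/
def IsMulticurve (F : Set SimpleCurve) : Prop :=
  F.Finite ∧ ∀ p : ℂ,
    ({c ∈ F | p ∈ c.carrier}).Subsingleton ∨
    (∃ c d : SimpleCurve, c ∈ F ∧ d ∈ F ∧ c ≠ d ∧
      p ∈ c.endpoints ∧ p ∈ d.endpoints ∧ {e ∈ F | p ∈ e.carrier} = {c, d})

/-- `G` is a partition of the multicurve `F`: `G` is a multicurve with the same
underlying point set, and every member of `F` is the union of some members of `G`. -/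
def IsPartitionOf (G F : Set SimpleCurve) : Prop :=
  IsMulticurve G ∧ MCUnion G = MCUnion F ∧
    ∀ c ∈ F, ∃ H ⊆ G, c.carrier = MCUnion H

/-- Two multicurves are equidecomposable if they admit partitions whose members are
matched bijectively into congruent pairs. -/
def Equidecomposable (F G : Set SimpleCurve) : Prop :=
  ∃ F' G' : Set SimpleCurve, IsPartitionOf F' F ∧ IsPartitionOf G' G ∧
    ∃ e : F' ≃ G', ∀ c : F', SimpleCurve.Congr c.1 (e c).1

/-! ### Basic facts on simple curves -/

/-- The relative interior of a simple curve. -/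
def SimpleCurve.inter (c : SimpleCurve) : Set ℂ := c.f '' Set.Ioo c.a c.b

/-- The set of all endpoints of a family. -/
def MCEnds (F : Set SimpleCurve) : Set ℂ := ⋃ c ∈ F, c.endpoints

theorem mem_MCUnion {F : Set SimpleCurve} {x : ℂ} :
    x ∈ MCUnion F ↔ ∃ c ∈ F, x ∈ c.carrier := by simp [MCUnion]

theorem mem_MCEnds {F : Set SimpleCurve} {x : ℂ} :
    x ∈ MCEnds F ↔ ∃ c ∈ F, x ∈ c.endpoints := by simp [MCEnds]

namespace SimpleCurve

variable (c : SimpleCurve)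

theorem inter_subset : c.inter ⊆ c.carrier := image_mono Ioo_subset_Icc_self

theorem mem_carrier_cases {x : ℂ} (hx : x ∈ c.carrier) : x ∈ c.inter ∨ x ∈ c.endpoints := by
  obtain ⟨t, ht, rfl⟩ := hx
  rcases eq_or_lt_of_le ht.1 with h | h
  · right; left; rw [h]
  rcases eq_or_lt_of_le ht.2 with h' | h'
  · right; right; rw [h']; rfl
  · left; exact ⟨t, ⟨h, h'⟩, rfl⟩

theorem endpoints_subset : c.endpoints ⊆ c.carrier := by
  rintro x (rfl | rfl)
  · exact ⟨_, left_mem_Icc.2 c.hab.le, rfl⟩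
  · exact ⟨_, right_mem_Icc.2 c.hab.le, rfl⟩

theorem not_endpoint_of_inter {x : ℂ} (hx : x ∈ c.inter) : x ∉ c.endpoints := by
  obtain ⟨t, ht, rfl⟩ := hx
  rintro (h | h)
  · exact ht.1.ne' (c.inj (Ioo_subset_Icc_self ht) (left_mem_Icc.2 c.hab.le) h)
  · exact ht.2.ne (c.inj (Ioo_subset_Icc_self ht) (right_mem_Icc.2 c.hab.le) h)

theorem isCompact_carrier : IsCompact c.carrier := isCompact_Icc.image_of_continuousOn c.cont

theorem isPreconnected_inter : IsPreconnected c.inter :=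
  isPreconnected_Ioo.image _ (c.cont.mono Ioo_subset_Icc_self)

theorem closure_inter : closure c.inter = c.carrier := by
  apply Subset.antisymm
  · exact closure_minimal c.inter_subset c.isCompact_carrier.isClosed
  · have h : closure (Ioo c.a c.b) = Icc c.a c.b := closure_Ioo c.hab.ne
    have := ContinuousOn.image_closure (f := c.f) (s := Ioo c.a c.b) (by rw [h]; exact c.cont)
    rwa [h] at this

theorem exists_two : ∃ u ∈ c.inter, ∃ v ∈ c.inter, u ≠ v := by
  obtain ⟨s, h1, h2⟩ := exists_between c.hab
  obtain ⟨t, h3, h4⟩ := exists_between h2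
  refine ⟨c.f s, ⟨s, ⟨h1, h2⟩, rfl⟩, c.f t, ⟨t, ⟨h1.trans h3, h4⟩, rfl⟩, fun h => ?_⟩
  exact h3.ne (c.inj ⟨h1.le, h2.le⟩ ⟨(h1.trans h3).le, h4.le⟩ h)

theorem inter_nonempty : c.inter.Nonempty := by
  obtain ⟨u, hu, _⟩ := c.exists_two
  exact ⟨u, hu⟩

/-- A preconnected subset of the curve meeting both sides of a parameter contains the point. -/
theorem mem_of_between {C : Set ℂ} (hC : IsPreconnected C) (hCc : C ⊆ c.carrier)
    {s r t : ℝ} (hs : s ∈ Icc c.a c.b) (ht : t ∈ Icc c.a c.b) (hsr : s ≤ r) (hrt : r ≤ t)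
    (hsC : c.f s ∈ C) (htC : c.f t ∈ C) : c.f r ∈ C := by
  have hr : r ∈ Icc c.a c.b := ⟨hs.1.trans hsr, hrt.trans ht.2⟩
  have h1 : IsClosed (c.f '' Icc c.a r) :=
    (isCompact_Icc.image_of_continuousOn (c.cont.mono (Icc_subset_Icc_right hr.2))).isClosed
  have h2 : IsClosed (c.f '' Icc r c.b) :=
    (isCompact_Icc.image_of_continuousOn (c.cont.mono (Icc_subset_Icc_left hr.1))).isClosed
  have := isPreconnected_closed_iff.1 hC _ _ h1 h2 (by
    intro x hx
    obtain ⟨u, hu, rfl⟩ := hCc hx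
    rcases le_total u r with h | h
    · exact Or.inl ⟨u, ⟨hu.1, h⟩, rfl⟩
    · exact Or.inr ⟨u, ⟨h, hu.2⟩, rfl⟩) ⟨_, hsC, s, ⟨hs.1, hsr⟩, rfl⟩ ⟨_, htC, t, ⟨hrt, ht.2⟩, rfl⟩
  obtain ⟨x, hxC, ⟨u, hu, rfl⟩, ⟨v, hv, huv⟩⟩ := this
  have : v = u := c.inj ⟨hr.1.trans hv.1, hv.2⟩ ⟨hu.1, hu.2.trans hr.2⟩ huv
  subst this
  have : v = r := le_antisymm hu.2 hv.1
  rwa [this] at hxC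

theorem not_preconnected_diff {x : ℂ} (hx : x ∈ c.inter) : ¬ IsPreconnected (c.carrier \ {x}) := by
  intro h
  obtain ⟨r, hr, rfl⟩ := hx
  have ha := left_mem_Icc.2 c.hab.le
  have hb := right_mem_Icc.2 c.hab.le
  have := c.mem_of_between h diff_subset ha hb hr.1.le hr.2.le
    ⟨⟨_, ha, rfl⟩, fun h => hr.1.ne (c.inj ha (Ioo_subset_Icc_self hr) h)⟩
    ⟨⟨_, hb, rfl⟩, fun h => hr.2.ne' (c.inj hb (Ioo_subset_Icc_self hr) h)⟩
  exact this.2 rfl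

theorem preconnected_diff {x : ℂ} (hx : x ∈ c.endpoints) : IsPreconnected (c.carrier \ {x}) := by
  rcases hx with rfl | rfl
  · have : c.carrier \ {c.f c.a} = c.f '' Ioc c.a c.b := by
      ext y; constructor
      · rintro ⟨⟨t, ht, rfl⟩, h⟩
        exact ⟨t, ⟨lt_of_le_of_ne ht.1 (fun h' => h (by rw [h']; rfl)), ht.2⟩, rfl⟩
      · rintro ⟨t, ht, rfl⟩
        exact ⟨⟨t, Ioc_subset_Icc_self ht, rfl⟩, fun h =>
          ht.1.ne' (c.inj (Ioc_subset_Icc_self ht) (left_mem_Icc.2 c.hab.le) h)⟩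
    rw [this]
    exact isPreconnected_Ioc.image _ (c.cont.mono Ioc_subset_Icc_self)
  · have : c.carrier \ {c.f c.b} = c.f '' Ico c.a c.b := by
      ext y; constructor
      · rintro ⟨⟨t, ht, rfl⟩, h⟩
        exact ⟨t, ⟨ht.1, lt_of_le_of_ne ht.2 (fun h' => h (by rw [h']; rfl))⟩, rfl⟩
      · rintro ⟨t, ht, rfl⟩
        exact ⟨⟨t, Ico_subset_Icc_self ht, rfl⟩, fun h =>
          ht.2.ne (c.inj (Ico_subset_Icc_self ht) (right_mem_Icc.2 c.hab.le) h)⟩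
    rw [show ({c.f c.b} : Set ℂ) = {c.f c.b} from rfl, this]
    exact isPreconnected_Ico.image _ (c.cont.mono Ico_subset_Icc_self)

theorem congr_inter {c d : SimpleCurve} {g : ℂ ≃ᵢ ℂ} (h : g '' c.carrier = d.carrier) {x : ℂ}
    (hx : x ∈ c.inter) : g x ∈ d.inter := by
  have hxd : g x ∈ d.carrier := h ▸ mem_image_of_mem g (c.inter_subset hx)
  refine (d.mem_carrier_cases hxd).resolve_right fun he => ?_
  have h1 := d.preconnected_diff he
  apply c.not_preconnected_diff hx
  have h2 := h1.image g.symm g.symm.continuous.continuousOn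
  have h3 : g.symm '' (d.carrier \ {g x}) = c.carrier \ {x} := by
    rw [← h, image_diff g.symm.injective, ← image_comp]
    simp
  rwa [h3] at h2

theorem Congr.symm {c d : SimpleCurve} {g : ℂ ≃ᵢ ℂ} (h : g '' c.carrier = d.carrier) :
    g.symm '' d.carrier = c.carrier := by
  rw [← h, ← image_comp]; simp

end SimpleCurve

/-! ### Basic facts on multicurves -/

theorem isMulticurve_iff {F : Set SimpleCurve} : IsMulticurve F ↔ F.Finite ∧
    (∀ c ∈ F, ∀ d ∈ F, ∀ p, p ∈ c.inter → p ∈ d.carrier → c = d) ∧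
    (∀ c ∈ F, ∀ d ∈ F, ∀ e ∈ F, ∀ p, p ∈ c.carrier → p ∈ d.carrier → p ∈ e.carrier →
      c = d ∨ d = e ∨ c = e) := by
  constructor
  · rintro ⟨hf, h⟩
    refine ⟨hf, fun c hc d hd p hpc hpd => ?_, fun c hc d hd e he p hpc hpd hpe => ?_⟩
    · rcases h p with h | ⟨u, v, -, -, -, hu, hv, huv⟩
      · exact h ⟨hc, c.inter_subset hpc⟩ ⟨hd, hpd⟩
      · have h1 : c ∈ ({u, v} : Set SimpleCurve) := huv ▸ ⟨hc, c.inter_subset hpc⟩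
        rcases h1 with rfl | rfl
        · exact absurd hu (c.not_endpoint_of_inter hpc)
        · exact absurd hv (SimpleCurve.not_endpoint_of_inter _ hpc)
    · rcases h p with h | ⟨u, v, -, -, -, hu, hv, huv⟩
      · exact Or.inl (h ⟨hc, hpc⟩ ⟨hd, hpd⟩)
      · have h1 : c ∈ ({u, v} : Set SimpleCurve) := huv ▸ ⟨hc, hpc⟩
        have h2 : d ∈ ({u, v} : Set SimpleCurve) := huv ▸ ⟨hd, hpd⟩
        have h3 : e ∈ ({u, v} : Set SimpleCurve) := huv ▸ ⟨he, hpe⟩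
        simp only [mem_insert_iff, mem_singleton_iff] at h1 h2 h3
        grind
  · rintro ⟨hf, h1, h2⟩
    refine ⟨hf, fun p => ?_⟩
    by_cases hs : ({c ∈ F | p ∈ c.carrier}).Subsingleton
    · exact Or.inl hs
    · right
      rw [not_subsingleton_iff] at hs
      obtain ⟨c, ⟨hc, hpc⟩, d, ⟨hd, hpd⟩, hcd⟩ := hs
      refine ⟨c, d, hc, hd, hcd, ?_, ?_, ?_⟩
      · exact (c.mem_carrier_cases hpc).resolve_left fun h => hcd (h1 c hc d hd p h hpd)
      · exact (d.mem_carrier_cases hpd).resolve_left fun h => hcd (h1 d hd c hc p h hpc).symm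
      · ext e
        simp only [mem_setOf_eq, mem_insert_iff, mem_singleton_iff]
        constructor
        · rintro ⟨he, hpe⟩
          have := h2 c hc d hd e he p hpc hpd hpe
          grind
        · rintro (rfl | rfl)
          · exact ⟨hc, hpc⟩
          · exact ⟨hd, hpd⟩

namespace IsMulticurve

theorem eq_of_inter {F : Set SimpleCurve} (hF : IsMulticurve F)
    {c d : SimpleCurve} (hc : c ∈ F) (hd : d ∈ F) {p : ℂ} (hpc : p ∈ c.inter)
    (hpd : p ∈ d.carrier) : c = d := (isMulticurve_iff.1 hF).2.1 c hc d hd p hpc hpd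

theorem not_ends {F : Set SimpleCurve} (hF : IsMulticurve F)
    {c : SimpleCurve} (hc : c ∈ F) {p : ℂ} (hpc : p ∈ c.inter) : p ∉ MCEnds F := by
  intro h
  obtain ⟨d, hd, hpd⟩ := mem_MCEnds.1 h
  have := hF.eq_of_inter hc hd hpc (d.endpoints_subset hpd)
  subst this
  exact c.not_endpoint_of_inter hpc hpd

theorem finite_ends {F : Set SimpleCurve} (hF : IsMulticurve F)
    : (MCEnds F).Finite :=
  hF.1.biUnion fun c _ => (Set.finite_singleton _).insert _

theorem mono {F : Set SimpleCurve} (hF : IsMulticurve F)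
    {G : Set SimpleCurve} (h : G ⊆ F) : IsMulticurve G := by
  have h' := isMulticurve_iff.1 hF
  refine isMulticurve_iff.2 ⟨hF.1.subset h, fun c hc d hd => h'.2.1 c (h hc) d (h hd),
    fun c hc d hd e he => h'.2.2 c (h hc) d (h hd) e (h he)⟩

theorem exists_member {F : Set SimpleCurve} (hF : IsMulticurve F)
    {C : Set ℂ} (hC : IsPreconnected C) (hne : C.Nonempty)
    (hCF : C ⊆ MCUnion F) (hCE : ∀ x ∈ C, x ∉ MCEnds F) : ∃ c ∈ F, C ⊆ c.inter := by
  obtain ⟨x, hx⟩ := hne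
  obtain ⟨c, hc, hxc⟩ := mem_MCUnion.1 (hCF hx)
  have key : ∀ y ∈ C, ∀ d ∈ F, y ∈ d.carrier → y ∈ d.inter := fun y hy d hd hyd =>
    (d.mem_carrier_cases hyd).resolve_right fun h => hCE y hy (mem_MCEnds.2 ⟨d, hd, h⟩)
  refine ⟨c, hc, fun y hy => key y hy c hc ?_⟩
  by_contra hyc
  have hcl : IsClosed (⋃ d ∈ F \ {c}, d.carrier) :=
    (hF.1.subset diff_subset).isClosed_biUnion fun d _ => d.isCompact_carrier.isClosed
  have h := isPreconnected_closed_iff.1 hC _ _ c.isCompact_carrier.isClosed hcl (by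
    intro z hz
    obtain ⟨d, hd, hzd⟩ := mem_MCUnion.1 (hCF hz)
    by_cases hdc : d = c
    · subst hdc; exact Or.inl hzd
    · exact Or.inr (mem_biUnion (show d ∈ F \ {c} from ⟨hd, hdc⟩) hzd)) ⟨x, hx, hxc⟩ (by
    obtain ⟨d, hd, hyd⟩ := mem_MCUnion.1 (hCF hy)
    refine ⟨y, hy, mem_biUnion (show d ∈ F \ {c} from ⟨hd, ?_⟩) hyd⟩
    rintro rfl; exact hyc hyd)
  obtain ⟨z, hz, hzc, hzd⟩ := h
  simp only [mem_iUnion] at hzd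
  obtain ⟨d, hd, hzd⟩ := hzd
  exact hd.2 (hF.eq_of_inter hc hd.1 (key z hz c hc hzc) hzd).symm

end IsMulticurve

/-! ### Cutting multicurves at finitely many points -/

theorem isPartitionOf_iff {P F : Set SimpleCurve} : IsPartitionOf P F ↔ IsMulticurve P ∧
    MCUnion P = MCUnion F ∧
    ∀ c ∈ F, ∀ x ∈ c.carrier, ∃ g ∈ P, x ∈ g.carrier ∧ g.carrier ⊆ c.carrier := by
  refine and_congr_right fun _ => and_congr_right fun _ => forall₂_congr fun c hc => ?_
  constructor
  · rintro ⟨H, hH, h⟩ x hx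
    rw [h] at hx
    obtain ⟨g, hg, hxg⟩ := mem_MCUnion.1 hx
    refine ⟨g, hH hg, hxg, fun y hy => ?_⟩
    rw [h]; exact mem_MCUnion.2 ⟨g, hg, hy⟩
  · intro h
    refine ⟨{g ∈ P | g.carrier ⊆ c.carrier}, fun g hg => hg.1, ?_⟩
    ext x; rw [mem_MCUnion]; constructor
    · intro hx
      obtain ⟨g, hg, h1, h2⟩ := h x hx
      exact ⟨g, ⟨hg, h2⟩, h1⟩
    · rintro ⟨g, hg, h1⟩; exact hg.2 h1

theorem IsPartitionOf.trans {P Q F : Set SimpleCurve} (h1 : IsPartitionOf P Q)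
    (h2 : IsPartitionOf Q F) : IsPartitionOf P F := by
  rw [isPartitionOf_iff] at *
  refine ⟨h1.1, h1.2.1.trans h2.2.1, fun c hc x hx => ?_⟩
  obtain ⟨g, hg, hxg, hgc⟩ := h2.2.2 c hc x hx
  obtain ⟨k, hk, hxk, hkg⟩ := h1.2.2 g hg x hxg
  exact ⟨k, hk, hxk, hkg.trans hgc⟩

theorem IsMulticurve.refl_partition {F : Set SimpleCurve} (hF : IsMulticurve F) :
    IsPartitionOf F F :=
  isPartitionOf_iff.2 ⟨hF, rfl, fun c hc _ hx => ⟨c, hc, hx, Subset.rfl⟩⟩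

theorem cut_one {F : Set SimpleCurve} (hF : IsMulticurve F) {c : SimpleCurve} (hc : c ∈ F)
    {p : ℂ} (hp : p ∈ c.inter) :
    ∃ P, IsPartitionOf P F ∧ p ∈ MCEnds P ∧ MCEnds P ⊆ insert p (MCEnds F) ∧
      MCEnds F ⊆ MCEnds P := by
  obtain ⟨t, ht, rfl⟩ := hp
  let c1 : SimpleCurve := ⟨c.a, t, ht.1, c.f, c.cont.mono (Icc_subset_Icc_right ht.2.le),
    c.inj.mono (Icc_subset_Icc_right ht.2.le)⟩
  let c2 : SimpleCurve := ⟨t, c.b, ht.2, c.f, c.cont.mono (Icc_subset_Icc_left ht.1.le),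
    c.inj.mono (Icc_subset_Icc_left ht.1.le)⟩
  have s1 : c1.carrier ⊆ c.carrier := image_mono (Icc_subset_Icc_right ht.2.le)
  have s2 : c2.carrier ⊆ c.carrier := image_mono (Icc_subset_Icc_left ht.1.le)
  have i1 : c1.inter ⊆ c.inter := image_mono (Ioo_subset_Ioo_right ht.2.le)
  have i2 : c2.inter ⊆ c.inter := image_mono (Ioo_subset_Ioo_left ht.1.le)
  have hcov : ∀ x ∈ c.carrier, x ∈ c1.carrier ∨ x ∈ c2.carrier := by
    rintro x ⟨u, hu, rfl⟩
    rcases le_total u t with h | h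
    · exact Or.inl ⟨u, ⟨hu.1, h⟩, rfl⟩
    · exact Or.inr ⟨u, ⟨h, hu.2⟩, rfl⟩
  have h12 : ∀ x, x ∈ c1.carrier → x ∈ c2.carrier → x = c.f t := by
    rintro x ⟨u, hu, rfl⟩ ⟨v, hv, huv⟩
    have hu' : u ∈ Icc c.a t := hu
    have hv' : v ∈ Icc t c.b := hv
    have : v = u := c.inj ⟨ht.1.le.trans hv'.1, hv'.2⟩ ⟨hu'.1, hu'.2.trans ht.2.le⟩ huv
    subst this
    rw [le_antisymm hu'.2 hv'.1]
  have e1 : c.f t ∈ c1.endpoints := Or.inr rfl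
  have e2 : c.f t ∈ c2.endpoints := Or.inl rfl
  have n1 := fun h => c1.not_endpoint_of_inter (x := c.f t) h e1
  have n2 := fun h => c2.not_endpoint_of_inter (x := c.f t) h e2
  have hti : c.f t ∈ c.inter := ⟨t, ht, rfl⟩
  obtain ⟨hfin, hA, hB⟩ := isMulticurve_iff.1 hF
  have key : ∀ d ∈ F \ {c}, c.f t ∉ d.carrier := fun d hd h => hd.2 (hA c hc d hd.1 _ hti h).symm
  let P : Set SimpleCurve := (F \ {c}) ∪ {c1, c2}
  have hP : ∀ d, d ∈ P ↔ (d ∈ F \ {c} ∨ d = c1 ∨ d = c2) := by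
    intro d; simp [P]; tauto
  have m1 : c1 ∈ P := (hP _).2 (Or.inr (Or.inl rfl))
  have m2 : c2 ∈ P := (hP _).2 (Or.inr (Or.inr rfl))
  refine ⟨P, isPartitionOf_iff.2 ⟨isMulticurve_iff.2 ⟨?_, ?_, ?_⟩, ?_, ?_⟩, ?_, ?_, ?_⟩
  · exact (hfin.subset diff_subset).union ((finite_singleton _).insert _)
  · intro x hx y hy p hpx hpy
    rcases (hP x).1 hx with hx | rfl | rfl <;> rcases (hP y).1 hy with hy | rfl | rfl
    · exact hA x hx.1 y hy.1 p hpx hpy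
    · exact absurd (hA x hx.1 c hc p hpx (s1 hpy)) hx.2
    · exact absurd (hA x hx.1 c hc p hpx (s2 hpy)) hx.2
    · exact absurd (hA c hc y hy.1 p (i1 hpx) hpy).symm hy.2
    · rfl
    · have := h12 p (c1.inter_subset hpx) hpy
      subst this; exact absurd hpx n1
    · exact absurd (hA c hc y hy.1 p (i2 hpx) hpy).symm hy.2
    · have := h12 p hpy (c2.inter_subset hpx)
      subst this; exact absurd hpx n2
    · rfl
  · intro x hx y hy z hz p hpx hpy hpz
    have hB' : ∀ d ∈ F \ {c}, ∀ e ∈ F \ {c}, p ∈ d.carrier → p ∈ e.carrier → p ∈ c.carrier →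
        d = e := by
      intro d hd e he h1 h2 h3
      rcases hB d hd.1 e he.1 c hc p h1 h2 h3 with h | h | h
      · exact h
      · exact absurd h he.2
      · exact absurd h hd.2
    have h3 : ∀ d ∈ F \ {c}, p ∈ d.carrier → p ∈ c1.carrier → p ∈ c2.carrier → False := by
      intro d hd h1 h2 h3
      have := h12 p h2 h3
      subst this
      exact key d hd h1
    have hx := (hP x).1 hx
    have hy := (hP y).1 hy
    have hz := (hP z).1 hz
    have s1' := @s1 p
    have s2' := @s2 p
    clear_value P c1 c2
    rcases hx with hx | rfl | rfl <;> rcases hy with hy | rfl | rfl <;>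
      rcases hz with hz | rfl | rfl
    · exact hB x hx.1 y hy.1 z hz.1 p hpx hpy hpz
    all_goals grind
  · ext x
    rw [mem_MCUnion, mem_MCUnion]
    constructor
    · rintro ⟨d, hd, hx⟩
      rcases (hP d).1 hd with hd | rfl | rfl
      · exact ⟨d, hd.1, hx⟩
      · exact ⟨c, hc, s1 hx⟩
      · exact ⟨c, hc, s2 hx⟩
    · rintro ⟨d, hd, hx⟩
      by_cases hdc : d = c
      · subst hdc
        rcases hcov x hx with h | h
        · exact ⟨c1, m1, h⟩
        · exact ⟨c2, m2, h⟩
      · exact ⟨d, (hP d).2 (Or.inl ⟨hd, hdc⟩), hx⟩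
  · intro d hd x hx
    by_cases hdc : d = c
    · subst hdc
      rcases hcov x hx with h | h
      · exact ⟨c1, m1, h, s1⟩
      · exact ⟨c2, m2, h, s2⟩
    · exact ⟨d, (hP d).2 (Or.inl ⟨hd, hdc⟩), hx, Subset.rfl⟩
  · exact mem_MCEnds.2 ⟨c1, m1, e1⟩
  · intro x hx
    obtain ⟨d, hd, hxd⟩ := mem_MCEnds.1 hx
    rcases (hP d).1 hd with hd | rfl | rfl
    · exact Or.inr (mem_MCEnds.2 ⟨d, hd.1, hxd⟩)
    · rcases hxd with rfl | rfl
      · exact Or.inr (mem_MCEnds.2 ⟨c, hc, Or.inl rfl⟩)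
      · exact Or.inl rfl
    · rcases hxd with rfl | rfl
      · exact Or.inl rfl
      · exact Or.inr (mem_MCEnds.2 ⟨c, hc, Or.inr rfl⟩)
  · intro x hx
    obtain ⟨d, hd, hxd⟩ := mem_MCEnds.1 hx
    by_cases hdc : d = c
    · subst hdc
      rcases hxd with rfl | rfl
      · exact mem_MCEnds.2 ⟨c1, m1, Or.inl rfl⟩
      · exact mem_MCEnds.2 ⟨c2, m2, Or.inr rfl⟩
    · exact mem_MCEnds.2 ⟨d, (hP d).2 (Or.inl ⟨hd, hdc⟩), hxd⟩

theorem cut_finite {F : Set SimpleCurve} (hF : IsMulticurve F) {D : Set ℂ} (hD : D.Finite) :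
    ∃ P, IsPartitionOf P F ∧ (∀ x ∈ D, x ∈ MCUnion F → x ∈ MCEnds P) ∧
      MCEnds P ⊆ D ∪ MCEnds F := by
  induction D, hD using Set.Finite.induction_on with
  | empty => exact ⟨F, hF.refl_partition, by simp, by simp⟩
  | @insert p D hp hD ih =>
    obtain ⟨P, hP, h1, h2⟩ := ih
    by_cases h : ∃ c ∈ P, p ∈ c.inter
    · obtain ⟨c, hc, hpc⟩ := h
      obtain ⟨Q, hQ, hpQ, hQ1, hQ2⟩ := cut_one hP.1 hc hpc
      refine ⟨Q, hQ.trans hP, ?_, ?_⟩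
      · rintro x (rfl | hx) hxF
        · exact hpQ
        · exact hQ2 (h1 x hx hxF)
      · intro x hx
        rcases hQ1 hx with rfl | hx
        · exact Or.inl (Or.inl rfl)
        · rcases h2 hx with hx | hx
          · exact Or.inl (Or.inr hx)
          · exact Or.inr hx
    · refine ⟨P, hP, ?_, ?_⟩
      · rintro x (rfl | hx) hxF
        · rw [← hP.2.1] at hxF
          obtain ⟨c, hc, hxc⟩ := mem_MCUnion.1 hxF
          rcases c.mem_carrier_cases hxc with h' | h'
          · exact absurd ⟨c, hc, h'⟩ h
          · exact mem_MCEnds.2 ⟨c, hc, h'⟩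
        · exact h1 x hx hxF
      · intro x hx
        rcases h2 hx with hx | hx
        · exact Or.inl (Or.inr hx)
        · exact Or.inr hx

/-! ### Orbits -/

/-- `n` steps of the partial map `S⁻¹ ∘ R`. -/
def Reach (R S : ℂ → ℂ → Prop) : ℕ → ℂ → ℂ → Prop
  | 0, x, z => z = x
  | n + 1, x, z => ∃ z' y, Reach R S n x z' ∧ R z' y ∧ S z y

/-- One half of the data. -/
structure Half (X A EX Y B EY : Set ℂ) (R S : ℂ → ℂ → Prop) : Prop where
  finE : EX.Finite
  Rfun : ∀ x y y', R x y → R x y' → y = y'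
  Sfun : ∀ x y y', S x y → S x y' → y = y'
  RX : ∀ x y, R x y → x ∈ X
  SX : ∀ x y, S x y → x ∈ X
  SA : ∀ x y, x ∈ A → ¬ S x y
  AX : A ⊆ X
  cov : ∃ P : Set SimpleCurve, IsMulticurve P ∧ X ⊆ MCUnion P ∧ MCEnds P ⊆ EX
  Rstep : ∀ C : Set ℂ, IsPreconnected C → C.Nonempty → C ⊆ X → (∀ x ∈ C, x ∉ EX) →
    ∃ g : ℂ ≃ᵢ ℂ, ∀ x ∈ C, R x (g x)
  Sstep : ∀ C : Set ℂ, IsPreconnected C → C.Nonempty → C ⊆ Y → (∀ y ∈ C, y ∉ EY) →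
    C ⊆ B ∨ ∃ g : ℂ ≃ᵢ ℂ, ∀ y ∈ C, S (g y) y

/-- Points whose orbit meets an exceptional point. -/
def Bad (EX EY : Set ℂ) (R S : ℂ → ℂ → Prop) (x : ℂ) : Prop :=
  ∃ n z, Reach R S n x z ∧ (z ∈ EX ∨ ∃ y, R z y ∧ y ∈ EY)

/-- The final relation between `A` and `B`. -/
def Orb (B : Set ℂ) (R S : ℂ → ℂ → Prop) (x y : ℂ) : Prop :=
  ∃ n z, Reach R S n x z ∧ R z y ∧ y ∈ B

section orbits

variable {X A EX Y B EY : Set ℂ} {R S : ℂ → ℂ → Prop}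

theorem reach_inj (H : Half X A EX Y B EY R S) (H' : Half Y B EY X A EX (flip R) (flip S))
    {n m : ℕ} {x x' z : ℂ} (hx : x ∈ A) (hx' : x' ∈ A) (h : Reach R S n x z)
    (h' : Reach R S m x' z) : n = m ∧ x = x' := by
  induction n generalizing m z with
  | zero =>
    cases m with
    | zero => exact ⟨rfl, h.symm.trans h'⟩
    | succ m =>
      obtain ⟨z', y, -, -, hS⟩ := h'
      have h : z = x := h
      subst h
      exact absurd hS (H.SA _ _ hx)
  | succ n ih =>
    obtain ⟨z1, y1, h1, hR1, hS1⟩ := h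
    cases m with
    | zero =>
      have h' : z = x' := h'
      subst h'
      exact absurd hS1 (H.SA _ _ hx')
    | succ m =>
      obtain ⟨z2, y2, h2, hR2, hS2⟩ := h'
      have := H.Sfun _ _ _ hS1 hS2
      subst this
      have := H'.Rfun _ _ _ hR1 hR2
      subst this
      obtain ⟨h3, h4⟩ := ih h1 h2
      exact ⟨by rw [h3], h4⟩

theorem finite_bad (H : Half X A EX Y B EY R S) (H' : Half Y B EY X A EX (flip R) (flip S)) :
    {x ∈ A | Bad EX EY R S x}.Finite := by
  have h1 : (EX ∪ ⋃ y ∈ EY, {z | R z y}).Finite :=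
    H.finE.union (H'.finE.biUnion fun y _ =>
      Set.Subsingleton.finite fun z hz z' hz' => H'.Rfun _ _ _ hz hz')
  refine (h1.biUnion (t := fun z => {x | x ∈ A ∧ ∃ n, Reach R S n x z}) fun z _ =>
    Set.Subsingleton.finite ?_).subset ?_
  · rintro x ⟨hx, n, hn⟩ x' ⟨hx', m, hm⟩
    exact (reach_inj H H' hx hx' hn hm).2
  · rintro x ⟨hx, n, z, hn, hz⟩
    refine mem_biUnion (x := z) ?_ ⟨hx, n, hn⟩
    rcases hz with hz | ⟨y, hR, hy⟩
    · exact Or.inl hz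
    · exact Or.inr (mem_biUnion hy hR)

theorem back_orbit (H : Half X A EX Y B EY R S) (H' : Half Y B EY X A EX (flip R) (flip S))
    {n m : ℕ} {x y z w : ℂ} (hx : x ∈ A) (h : Reach R S n x z) (hR : R z y)
    (h' : Reach (flip R) (flip S) m y w) : ∃ n' z', Reach R S n' x z' ∧ R z' w := by
  induction m generalizing w with
  | zero =>
    have h' : w = y := h'
    subst h'
    exact ⟨n, z, h, hR⟩
  | succ m ih =>
    obtain ⟨w', z1, h1, hR1, hS1⟩ := h'
    obtain ⟨n', z', h2, hR2⟩ := ih h1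
    have := H'.Rfun _ _ _ hR1 hR2
    subst this
    cases n' with
    | zero =>
      have h2 : z1 = x := h2
      subst h2
      exact absurd hS1 (H.SA _ _ hx)
    | succ k =>
      obtain ⟨z3, y3, h3, hR3, hS3⟩ := h2
      have := H.Sfun _ _ _ hS1 hS3
      subst this
      exact ⟨k, z3, h3, hR3⟩

theorem orb_not_bad (H : Half X A EX Y B EY R S) (H' : Half Y B EY X A EX (flip R) (flip S))
    {x y : ℂ} (hx : x ∈ A) (hb : ¬ Bad EX EY R S x) (h : Orb B R S x y) :
    ¬ Bad EY EX (flip R) (flip S) y := by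
  obtain ⟨n, z, hn, hR, -⟩ := h
  rintro ⟨m, w, hm, hw⟩
  obtain ⟨n', z', h1, h2⟩ := back_orbit H H' hx hn hR hm
  rcases hw with hw | ⟨z2, hz2, hz2E⟩
  · exact hb ⟨n', z', h1, Or.inr ⟨w, h2, hw⟩⟩
  · have := H'.Rfun _ _ _ hz2 h2
    subst this
    exact hb ⟨n', z2, h1, Or.inl hz2E⟩

theorem orb_orb (H : Half X A EX Y B EY R S) (H' : Half Y B EY X A EX (flip R) (flip S))
    {x x' y : ℂ} (hx : x ∈ A) (h : Orb B R S x y) (h' : Orb A (flip R) (flip S) y x') :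
    x = x' := by
  obtain ⟨n, z, hn, hR, -⟩ := h
  obtain ⟨m, w, hm, hR', hx'⟩ := h'
  obtain ⟨n', z', h1, h2⟩ := back_orbit H H' hx hn hR hm
  have := H'.Rfun _ _ _ h2 hR'
  subst this
  exact (reach_inj H H' (n := n') (m := 0) hx hx' h1 rfl).2

/-- Finitely many disjoint isometric copies of a nondegenerate connected set fit in a curve. -/
theorem finite_copies (c : SimpleCurve) {C : Set ℂ} (hC : IsPreconnected C) {u v : ℂ}
    (hu : u ∈ C) (hv : v ∈ C) (huv : u ≠ v) (h : ℕ → ℂ ≃ᵢ ℂ)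
    (hd : ∀ n m, ∀ x ∈ C, ∀ y ∈ C, h n x = h m y → n = m) :
    {n | h n '' C ⊆ c.carrier}.Finite := by
  have hδ : 0 < dist u v := dist_pos.2 huv
  have huc := isCompact_Icc.uniformContinuousOn_of_continuous c.cont
  obtain ⟨ε, hε, hεc⟩ := Metric.uniformContinuousOn_iff.1 huc _ hδ
  have hex : ∀ n : {n | h n '' C ⊆ c.carrier}, ∃ s t : ℝ, s ∈ Icc c.a c.b ∧ t ∈ Icc c.a c.b ∧
      s + ε ≤ t ∧ c.f s ∈ h n '' C ∧ c.f t ∈ h n '' C := by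
    rintro ⟨n, hn⟩
    obtain ⟨s, hs, hsu⟩ := hn (mem_image_of_mem _ hu)
    obtain ⟨t, ht, htv⟩ := hn (mem_image_of_mem _ hv)
    have hst : ε ≤ dist s t := by
      by_contra hlt
      have := hεc s hs t ht (not_le.1 hlt)
      rw [hsu, htv, (h n).dist_eq] at this
      exact lt_irrefl _ this
    rw [Real.dist_eq] at hst
    rcases le_abs.1 hst with h1 | h1
    · exact ⟨t, s, ht, hs, by linarith, htv ▸ mem_image_of_mem _ hv, hsu ▸ mem_image_of_mem _ hu⟩
    · exact ⟨s, t, hs, ht, by linarith, hsu ▸ mem_image_of_mem _ hu, htv ▸ mem_image_of_mem _ hv⟩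
  choose s t hs ht hst hsC htC using hex
  have hsub : ∀ n, ∀ r ∈ Icc (s n) (t n), c.f r ∈ h n '' C := fun n r hr =>
    c.mem_of_between (hC.image _ (h n).continuous.continuousOn) n.2 (hs n) (ht n) hr.1 hr.2
      (hsC n) (htC n)
  have hdisj : Pairwise (Function.onFun Disjoint fun n => Icc (s n) (t n)) := by
    intro n m hnm
    refine Set.disjoint_left.2 fun r hr hr' => hnm ?_
    obtain ⟨x, hx, hx'⟩ := hsub n r hr
    obtain ⟨y, hy, hy'⟩ := hsub m r hr'
    exact Subtype.ext (hd n m x hx y hy (hx'.trans hy'.symm))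
  have hfin := MeasureTheory.Measure.finite_const_le_meas_of_disjoint_iUnion
    (MeasureTheory.volume : MeasureTheory.Measure ℝ) (ε := ENNReal.ofReal ε) (by simpa using hε)
    (As := fun n => Icc (s n) (t n)) (fun n => measurableSet_Icc) hdisj (by
      refine ne_top_of_le_ne_top (b := MeasureTheory.volume (Icc c.a c.b)) (by simp)
        (MeasureTheory.measure_mono (iUnion_subset fun n r hr => ?_))
      exact ⟨(hs n).1.trans hr.1, hr.2.trans (ht n).2⟩)
  have huniv : {n | ENNReal.ofReal ε ≤ MeasureTheory.volume (Icc (s n) (t n))} = univ := by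
    ext n
    simp only [mem_setOf_eq, mem_univ, iff_true, Real.volume_Icc]
    exact ENNReal.ofReal_le_ofReal (by linarith [hst n])
  rw [huniv, Set.finite_univ_iff] at hfin
  exact Set.toFinite _

theorem orb_exists (H : Half X A EX Y B EY R S) (H' : Half Y B EY X A EX (flip R) (flip S))
    {J : Set ℂ} (hJ : IsPreconnected J) {u v : ℂ} (hu : u ∈ J) (hv : v ∈ J) (huv : u ≠ v)
    (hJA : J ⊆ A) (hb : ∀ x ∈ J, ¬ Bad EX EY R S x) :
    ∃ h : ℂ ≃ᵢ ℂ, ∀ x ∈ J, Orb B R S x (h x) := by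
  by_contra hno
  have step : ∀ n, ∃ h : ℂ ≃ᵢ ℂ, ∀ x ∈ J, Reach R S n x (h x) := by
    intro n
    induction n with
    | zero => exact ⟨IsometryEquiv.refl ℂ, fun x _ => rfl⟩
    | succ n ih =>
      obtain ⟨h, hh⟩ := ih
      have hXn : h '' J ⊆ X := by
        rintro _ ⟨x, hx, rfl⟩
        have := hh x hx
        cases n with
        | zero =>
          have this : h x = x := this
          rw [this]; exact H.AX (hJA hx)
        | succ n =>
          obtain ⟨_, _, _, _, hS⟩ := this
          exact H.SX _ _ hS
      obtain ⟨g, hg⟩ := H.Rstep (h '' J) (hJ.image _ h.continuous.continuousOn) ⟨_, u, hu, rfl⟩ hXn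
        (by rintro _ ⟨x, hx, rfl⟩ hE; exact hb x hx ⟨n, _, hh x hx, Or.inl hE⟩)
      have hg' : ∀ x ∈ J, R (h x) (g (h x)) := fun x hx => hg _ ⟨x, hx, rfl⟩
      let k := h.trans g
      have hk : ∀ x ∈ J, R (h x) (k x) := hg'
      rcases H.Sstep (k '' J) (hJ.image _ k.continuous.continuousOn) ⟨_, u, hu, rfl⟩
        (by rintro _ ⟨x, hx, rfl⟩; exact H'.RX _ _ (hk x hx))
        (by rintro _ ⟨x, hx, rfl⟩ hE; exact hb x hx ⟨n, _, hh x hx, Or.inr ⟨_, hk x hx, hE⟩⟩)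
        with hB | ⟨q, hq⟩
      · exact absurd ⟨k, fun x hx => ⟨n, h x, hh x hx, hk x hx, hB ⟨x, hx, rfl⟩⟩⟩ hno
      · exact ⟨k.trans q, fun x hx => ⟨h x, k x, hh x hx, hk x hx, hq _ ⟨x, hx, rfl⟩⟩⟩
  choose h hh using step
  obtain ⟨P, hP, hXP, hPE⟩ := H.cov
  have hfin : (⋃ c ∈ P, {n | h n '' J ⊆ c.carrier}).Finite :=
    hP.1.biUnion fun c _ => finite_copies c hJ hu hv huv h fun n m x hx y hy hxy =>
      (reach_inj H H' (hJA hx) (hJA hy) (hh n x hx) (hxy ▸ hh m y hy)).1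
  refine Set.infinite_univ (α := ℕ) (hfin.subset fun n _ => ?_)
  obtain ⟨c, hc, hJc⟩ := hP.exists_member (C := h n '' J)
    (hJ.image _ (h n).continuous.continuousOn) ⟨_, u, hu, rfl⟩ (by
      rintro _ ⟨x, hx, rfl⟩
      apply hXP
      have := hh n x hx
      cases n with
      | zero =>
        have this : h 0 x = x := this
        rw [this]; exact H.AX (hJA hx)
      | succ n =>
        obtain ⟨_, _, _, _, hS⟩ := this
        exact H.SX _ _ hS) (by
      rintro _ ⟨x, hx, rfl⟩ hE
      exact hb x hx ⟨n, _, hh n x hx, Or.inl (hPE hE)⟩)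
  exact mem_biUnion hc (hJc.trans c.inter_subset)

end orbits

/-! ### Matching members -/

theorem exists_matching {P Q : Set SimpleCurve} (hP : IsMulticurve P) (hQ : IsMulticurve Q)
    {O O' : ℂ → ℂ → Prop}
    (h : ∀ J ∈ P, ∃ h : ℂ ≃ᵢ ℂ, ∀ x ∈ J.inter, O x (h x) ∧ h x ∈ MCUnion Q ∧ h x ∉ MCEnds Q)
    (h' : ∀ K ∈ Q, ∃ k : ℂ ≃ᵢ ℂ, ∀ y ∈ K.inter, O' y (k y) ∧ k y ∈ MCUnion P ∧ k y ∉ MCEnds P)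
    (hO : ∀ J ∈ P, ∀ x ∈ J.inter, ∀ y x', O x y → O' y x' → x = x')
    (hO' : ∀ K ∈ Q, ∀ y ∈ K.inter, ∀ x y', O' y x → O x y' → y = y') :
    ∃ e : P ≃ Q, ∀ c : P, SimpleCurve.Congr c.1 (e c).1 := by
  have a1 : ∀ J : P, ∃ h : ℂ ≃ᵢ ℂ, ∃ K : Q, (∀ x ∈ J.1.inter, O x (h x)) ∧
      h '' J.1.inter ⊆ K.1.inter := by
    rintro ⟨J, hJ⟩
    obtain ⟨g, hg⟩ := h J hJ
    obtain ⟨K, hK, hJK⟩ := hQ.exists_member (C := g '' J.inter)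
      (J.isPreconnected_inter.image _ g.continuous.continuousOn) (J.inter_nonempty.image _)
      (by rintro _ ⟨x, hx, rfl⟩; exact (hg x hx).2.1)
      (by rintro _ ⟨x, hx, rfl⟩; exact (hg x hx).2.2)
    exact ⟨g, ⟨K, hK⟩, fun x hx => (hg x hx).1, hJK⟩
  have a2 : ∀ K : Q, ∃ k : ℂ ≃ᵢ ℂ, ∃ J : P, (∀ y ∈ K.1.inter, O' y (k y)) ∧
      k '' K.1.inter ⊆ J.1.inter := by
    rintro ⟨K, hK⟩
    obtain ⟨g, hg⟩ := h' K hK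
    obtain ⟨J, hJ, hJK⟩ := hP.exists_member (C := g '' K.inter)
      (K.isPreconnected_inter.image _ g.continuous.continuousOn) (K.inter_nonempty.image _)
      (by rintro _ ⟨x, hx, rfl⟩; exact (hg x hx).2.1)
      (by rintro _ ⟨x, hx, rfl⟩; exact (hg x hx).2.2)
    exact ⟨g, ⟨J, hJ⟩, fun x hx => (hg x hx).1, hJK⟩
  choose φ κ hφ hκ using a1
  choose ψ ι hψ hι using a2
  have b1 : ∀ J, ι (κ J) = J := by
    intro J
    obtain ⟨x, hx⟩ := J.1.inter_nonempty
    have hy := hκ J ⟨x, hx, rfl⟩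
    have hz := hι _ ⟨_, hy, rfl⟩
    have := hO J J.2 x hx _ _ (hφ J x hx) (hψ _ _ hy)
    rw [← this] at hz
    exact Subtype.ext (hP.eq_of_inter (ι (κ J)).2 J.2 hz (J.1.inter_subset hx))
  have b2 : ∀ K, κ (ι K) = K := by
    intro K
    obtain ⟨x, hx⟩ := K.1.inter_nonempty
    have hy := hι K ⟨x, hx, rfl⟩
    have hz := hκ _ ⟨_, hy, rfl⟩
    have := hO' K K.2 x hx _ _ (hψ K x hx) (hφ _ _ hy)
    rw [← this] at hz
    exact Subtype.ext (hQ.eq_of_inter (κ (ι K)).2 K.2 hz (K.1.inter_subset hx))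
  refine ⟨⟨κ, ι, b1, b2⟩, fun J => ⟨φ J, ?_⟩⟩
  have b3 : φ J '' J.1.inter = (κ J).1.inter := by
    apply Subset.antisymm (hκ J)
    intro y hy
    have hz := hι _ ⟨_, hy, rfl⟩
    rw [b1] at hz
    exact ⟨_, hz, (hO' _ (κ J).2 y hy _ _ (hψ _ y hy) (hφ J _ hz)).symm⟩
  change φ J '' J.1.carrier = (κ J).1.carrier
  rw [← SimpleCurve.closure_inter, ← SimpleCurve.closure_inter, ← b3]
  exact (φ J).toHomeomorph.image_closure _

/-! ### The relation attached to an equidecomposition -/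

/-- The point relation of an equidecomposition. -/
def PRel {P Q : Set SimpleCurve} (e : P ≃ Q) (g : P → ℂ ≃ᵢ ℂ) (x y : ℂ) : Prop :=
  ∃ c : P, x ∈ c.1.inter ∧ y ∈ (e c).1.inter ∧ y = g c x

theorem PRel.fun_right {P Q : Set SimpleCurve} (hP : IsMulticurve P) {e : P ≃ Q}
    {g : P → ℂ ≃ᵢ ℂ} {x y y' : ℂ} (h : PRel e g x y) (h' : PRel e g x y') : y = y' := by
  obtain ⟨c, hc, -, rfl⟩ := h
  obtain ⟨d, hd, -, rfl⟩ := h'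
  rw [Subtype.ext (hP.eq_of_inter c.2 d.2 hc (d.1.inter_subset hd))]

theorem PRel.flip_eq {P Q : Set SimpleCurve} (e : P ≃ Q) (g : P → ℂ ≃ᵢ ℂ) :
    flip (PRel e g) = PRel e.symm (fun d => (g (e.symm d)).symm) := by
  ext y x
  constructor
  · rintro ⟨c, h1, h2, h3⟩
    exact ⟨e c, h2, by simpa using h1, by simp [h3]⟩
  · rintro ⟨d, h1, h2, h3⟩
    exact ⟨e.symm d, h2, by simpa using h1, by simp [h3]⟩

theorem half_of {F G F' G' P Q P' Q' : Set SimpleCurve}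
    (hF : IsMulticurve F) (hG : IsMulticurve G) (hF' : F' ⊆ F)
    (hP : IsPartitionOf P F) (hP' : IsPartitionOf P' F') (hQ' : IsPartitionOf Q' G')
    (e : P ≃ Q) (g : P → ℂ ≃ᵢ ℂ) (hg : ∀ c, g c '' c.1.carrier = (e c).1.carrier)
    (e' : P' ≃ Q') (g' : P' → ℂ ≃ᵢ ℂ) (hg' : ∀ c, g' c '' c.1.carrier = (e' c).1.carrier) :
    Half (MCUnion F) (MCUnion (F \ F') \ MCEnds F) (MCEnds F ∪ MCEnds P ∪ MCEnds P')
      (MCUnion G) (MCUnion (G \ G') \ MCEnds G) (MCEnds G ∪ MCEnds Q ∪ MCEnds Q')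
      (PRel e g) (PRel e' g') where
  finE := (hF.finite_ends.union hP.1.finite_ends).union hP'.1.finite_ends
  Rfun _ _ _ h h' := h.fun_right hP.1 h'
  Sfun _ _ _ h h' := h.fun_right hP'.1 h'
  RX := by
    rintro x y ⟨c, hc, -⟩
    rw [← hP.2.1]
    exact mem_MCUnion.2 ⟨c, c.2, c.1.inter_subset hc⟩
  SX := by
    rintro x y ⟨c, hc, -⟩
    have : x ∈ MCUnion P' := mem_MCUnion.2 ⟨c, c.2, c.1.inter_subset hc⟩
    rw [hP'.2.1] at this
    obtain ⟨d, hd, hx⟩ := mem_MCUnion.1 this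
    exact mem_MCUnion.2 ⟨d, hF' hd, hx⟩
  SA := by
    rintro x y ⟨hxA, hxE⟩ ⟨c, hc, -⟩
    have : x ∈ MCUnion P' := mem_MCUnion.2 ⟨c, c.2, c.1.inter_subset hc⟩
    rw [hP'.2.1] at this
    obtain ⟨d, hd, hx⟩ := mem_MCUnion.1 this
    obtain ⟨b, hb, hxb⟩ := mem_MCUnion.1 hxA
    have hxb' := (b.mem_carrier_cases hxb).resolve_right fun h => hxE (mem_MCEnds.2 ⟨b, hb.1, h⟩)
    have := hF.eq_of_inter hb.1 (hF' hd) hxb' hx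
    subst this
    exact hb.2 hd
  AX := by
    rintro x ⟨hxA, -⟩
    obtain ⟨b, hb, hxb⟩ := mem_MCUnion.1 hxA
    exact mem_MCUnion.2 ⟨b, hb.1, hxb⟩
  cov := ⟨F, hF, Subset.rfl, fun x hx => Or.inl (Or.inl hx)⟩
  Rstep := by
    intro C hC hne hCX hCE
    obtain ⟨c, hc, hCc⟩ := hP.1.exists_member hC hne (by rwa [hP.2.1])
      (fun x hx h => hCE x hx (Or.inl (Or.inr h)))
    exact ⟨g ⟨c, hc⟩, fun x hx => ⟨⟨c, hc⟩, hCc hx, SimpleCurve.congr_inter (hg _) (hCc hx), rfl⟩⟩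
  Sstep := by
    intro C hC hne hCX hCE
    obtain ⟨b, hb, hCb⟩ := hG.exists_member hC hne hCX
      (fun x hx h => hCE x hx (Or.inl (Or.inl h)))
    by_cases hb' : b ∈ G'
    · right
      obtain ⟨d, hd, hCd⟩ := hQ'.1.exists_member hC hne (by
        rw [hQ'.2.1]
        exact fun x hx => mem_MCUnion.2 ⟨b, hb', b.inter_subset (hCb hx)⟩)
        (fun x hx h => hCE x hx (Or.inr h))
      obtain ⟨c, hc⟩ := e'.surjective ⟨d, hd⟩
      refine ⟨(g' c).symm, fun y hy => ⟨c, ?_, ?_, by simp⟩⟩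
      · refine SimpleCurve.congr_inter (SimpleCurve.Congr.symm (hg' c)) ?_
        rw [hc]; exact hCd hy
      · rw [hc]; exact hCd hy
    · left
      exact fun x hx => ⟨mem_MCUnion.2 ⟨b, ⟨hb, hb'⟩, b.inter_subset (hCb hx)⟩,
        fun h => hCE x hx (Or.inl (Or.inl h))⟩

/-- Every member of a cut is carried by one isometry along the orbits. -/
theorem cut_carried {F₀ G₀ PA PB : Set SimpleCurve} {X EX Y EY NA NB : Set ℂ}
    {R S : ℂ → ℂ → Prop} (hPB : IsPartitionOf PB G₀) (hPA : IsPartitionOf PA F₀)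
    (H : Half X (MCUnion F₀ \ NA) EX Y (MCUnion G₀ \ NB) EY R S)
    (H' : Half Y (MCUnion G₀ \ NB) EY X (MCUnion F₀ \ NA) EX (flip R) (flip S))
    (hA : ∀ x ∈ {x ∈ MCUnion F₀ \ NA | Bad EX EY R S x} ∪ EX, x ∈ MCUnion F₀ → x ∈ MCEnds PA)
    (hNA : NA ⊆ EX) (hG₀ : MCEnds G₀ ⊆ EY)
    (hB : MCEnds PB ⊆
      {y ∈ MCUnion G₀ \ NB | Bad EY EX (flip R) (flip S) y} ∪ EY ∪ MCEnds G₀) :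
    ∀ J ∈ PA, (∀ x ∈ J.inter, x ∈ MCUnion F₀ \ NA) ∧ ∃ h : ℂ ≃ᵢ ℂ, ∀ x ∈ J.inter,
      Orb (MCUnion G₀ \ NB) R S x (h x) ∧ h x ∈ MCUnion PB ∧ h x ∉ MCEnds PB := by
  intro J hJ
  have hU : ∀ x ∈ J.inter, x ∈ MCUnion F₀ := by
    intro x hx
    rw [← hPA.2.1]
    exact mem_MCUnion.2 ⟨J, hJ, J.inter_subset hx⟩
  have hE : ∀ x ∈ J.inter, x ∉ EX := fun x hx h =>
    hPA.1.not_ends hJ hx (hA x (Or.inr h) (hU x hx))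
  have hJA : ∀ x ∈ J.inter, x ∈ MCUnion F₀ \ NA := fun x hx =>
    ⟨hU x hx, fun h => hE x hx (hNA h)⟩
  have hbad : ∀ x ∈ J.inter, ¬ Bad EX EY R S x := fun x hx h =>
    hPA.1.not_ends hJ hx (hA x (Or.inl ⟨hJA x hx, h⟩) (hU x hx))
  refine ⟨hJA, ?_⟩
  obtain ⟨u, hu, v, hv, huv⟩ := J.exists_two
  obtain ⟨h, hh⟩ := orb_exists H H' J.isPreconnected_inter hu hv huv hJA hbad
  refine ⟨h, fun x hx => ⟨hh x hx, ?_, fun hend => ?_⟩⟩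
  · obtain ⟨_, _, _, _, hy⟩ := hh x hx
    rw [hPB.2.1]; exact hy.1
  · have hnb := orb_not_bad H H' (hJA x hx) (hbad x hx) (hh x hx)
    have hEY : h x ∉ EY := fun hy => hnb ⟨0, _, rfl, Or.inl hy⟩
    rcases hB hend with (h1 | h1) | h1
    · exact hnb h1.2
    · exact hEY h1
    · exact hEY (hG₀ h1)

theorem MCEnds_mono {F G : Set SimpleCurve} (h : F ⊆ G) : MCEnds F ⊆ MCEnds G :=
  biUnion_subset_biUnion_left h

/-- If `F` and `G` are equidecomposable multicurves, and
`F' ⊆ F`, `G' ⊆ G` are subfamilies which are themselves equidecomposable multicurves,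
then `F \ F'` and `G \ G'` are equidecomposable. -/
theorem equidecomposable_diff
    (F G F' G' : Set SimpleCurve)
    (hF : IsMulticurve F) (hG : IsMulticurve G)
    (hFG : Equidecomposable F G)
    (hF' : F' ⊆ F) (hG' : G' ⊆ G)
    (hF'm : IsMulticurve F') (hG'm : IsMulticurve G')
    (hFG' : Equidecomposable F' G') :
    Equidecomposable (F \ F') (G \ G') := by
  obtain ⟨P, Q, hP, hQ, e, he⟩ := hFG
  obtain ⟨P', Q', hP', hQ', e', he'⟩ := hFG'
  choose g hg using he
  choose g' hg' using he'
  have H := half_of hF hG hF' hP hP' hQ' e g hg e' g' hg'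
  have H' := half_of hG hF hG' hQ hQ' hP' e.symm (fun d => (g (e.symm d)).symm)
    (fun d => by
      have := SimpleCurve.Congr.symm (hg (e.symm d))
      rwa [e.apply_symm_apply] at this)
    e'.symm (fun d => (g' (e'.symm d)).symm)
    (fun d => by
      have := SimpleCurve.Congr.symm (hg' (e'.symm d))
      rwa [e'.apply_symm_apply] at this)
  rw [← PRel.flip_eq, ← PRel.flip_eq] at H'
  generalize PRel e g = R at H H'
  generalize PRel e' g' = S at H H'
  have hEX : MCEnds F ⊆ MCEnds F ∪ MCEnds P ∪ MCEnds P' := fun x hx => Or.inl (Or.inl hx)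
  have hEY : MCEnds G ⊆ MCEnds G ∪ MCEnds Q ∪ MCEnds Q' := fun x hx => Or.inl (Or.inl hx)
  have hEX' := (MCEnds_mono (diff_subset (s := F) (t := F'))).trans hEX
  have hEY' := (MCEnds_mono (diff_subset (s := G) (t := G'))).trans hEY
  generalize MCEnds F ∪ MCEnds P ∪ MCEnds P' = EX at *
  generalize MCEnds G ∪ MCEnds Q ∪ MCEnds Q' = EY at *
  obtain ⟨PA, hPA, hA1, hA2⟩ := cut_finite (hF.mono (diff_subset (t := F')))
    ((finite_bad H H').union H.finE)
  obtain ⟨PB, hPB, hB1, hB2⟩ := cut_finite (hG.mono (diff_subset (t := G')))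
    ((finite_bad H' H).union H'.finE)
  have cA := cut_carried hPB hPA H H' hA1 hEX hEY' hB2
  have cB := cut_carried hPA hPB H' H hB1 hEY hEX' hA2
  exact ⟨PA, PB, hPA, hPB, exists_matching hPA.1 hPB.1 (fun J hJ => (cA J hJ).2)
    (fun K hK => (cB K hK).2)
    (fun J hJ x hx y x' h1 h2 => orb_orb H H' ((cA J hJ).1 x hx) h1 h2)
    (fun K hK y hy x y' h1 h2 => orb_orb H' H ((cB K hK).1 y hy) h1 h2)⟩
end
end
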